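/- arXiv:2007.05668 — 2 statements merged into one kernel-verified Lean document; each statement's English description precedes it below -/
import Mathlib

section
/- One-dimensional weighted Gagliardo–Nirenberg interpolation (Lemma 2.18): Let p₀, p₂ ∈ [1,∞], p₁ ∈ [1,∞) and σ₀, σ₁, σ₂ ∈ ℝ satisfy 1/p₂ + 1/p₀ = 2/p₁, σ₀ + σ₂ = 2σ₁, 2 − (1/p₂ − 1/p₀) > σ₂ − σ₀, and σ₁ > −1/p₁. Then there is a constant C, depending only on the exponents, such that for every f ∈ C²((0,∞)) with ‖x^{σ₀} f‖_{L^{p₀}(0,∞)} < ∞ and ‖x^{σ₂} f″‖_{L^{p₂}(0,∞)} < ∞, ‖x^{σ₁} f′‖_{L^{p₁}(0,∞)} ≤ C ‖x^{σ₀} f‖_{L^{p₀}(0,∞)}^{1/2} ‖x^{σ₂} f″‖_{L^{p₂}(0,∞)}^{1/2}. -/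
open MeasureTheory Set
open scoped ENNReal

/-- The weighted Lebesgue norm `‖x^σ f‖_{L^p(0,∞)}`, as an extended nonnegative real
(so that the exponent `p = ∞` is allowed). -/
noncomputable def wLp (σ : ℝ) (p : ℝ≥0∞) (f : ℝ → ℝ) : ℝ≥0∞ :=
  eLpNorm (fun x => x ^ σ * f x) p (volume.restrict (Set.Ioi 0))

/-- A continuous function attains on each subinterval a value at most its `L¹`-average. -/
theorem exists_abs_le_integral {u : ℝ → ℝ} {a b c d : ℝ} (hac : a ≤ c) (hcd : c ≤ d) (hdb : d ≤ b)
    (hu : ContinuousOn u (Icc a b)) :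
    ∃ y ∈ Icc c d, (d - c) * |u y| ≤ ∫ y in a..b, |u y| := by
  have hsub : Icc c d ⊆ Icc a b := Icc_subset_Icc hac hdb
  obtain ⟨y, hy, hmin⟩ := isCompact_Icc.exists_isMinOn (nonempty_Icc.2 hcd) (hu.mono hsub).abs
  refine ⟨y, hy, ?_⟩
  have hint : IntervalIntegrable (fun z => |u z|) volume a b :=
    ContinuousOn.intervalIntegrable_of_Icc (by linarith) hu.abs
  calc (d - c) * |u y| = ∫ _ in c..d, |u y| := by simp
    _ ≤ ∫ z in c..d, |u z| :=
        intervalIntegral.integral_mono_on hcd (by simp)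
          (ContinuousOn.intervalIntegrable_of_Icc hcd (hu.mono hsub).abs) (fun z hz => hmin hz)
    _ ≤ ∫ z in a..b, |u z| :=
        intervalIntegral.integral_mono_interval hac hcd hdb
          (Filter.Eventually.of_forall fun _ => abs_nonneg _) hint

/-- Two values of a `C¹` function on `[a, b]` differ by at most the `L¹`-norm of its derivative. -/
theorem abs_sub_le_integral_abs_deriv {g h : ℝ → ℝ} {a b x y : ℝ}
    (hg : ∀ x ∈ Icc a b, HasDerivAt g (h x) x) (hh : ContinuousOn h (Icc a b))
    (hx : x ∈ Icc a b) (hy : y ∈ Icc a b) :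
    |g x - g y| ≤ ∫ y in a..b, |h y| := by
  wlog hyx : y ≤ x generalizing x y
  · rw [abs_sub_comm]
    exact this hy hx (le_of_not_ge hyx)
  have hsub : Icc y x ⊆ Icc a b := Icc_subset_Icc hy.1 hx.2
  have hint : IntervalIntegrable (fun z => |h z|) volume a b :=
    ContinuousOn.intervalIntegrable_of_Icc (hx.1.trans hx.2) hh.abs
  rw [← intervalIntegral.integral_eq_sub_of_hasDerivAt (f' := h)
    (fun z hz => hg z (hsub (by rwa [uIcc_of_le hyx] at hz)))
    (ContinuousOn.intervalIntegrable_of_Icc hyx (hh.mono hsub))]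
  exact (intervalIntegral.abs_integral_le_integral_abs hyx).trans
    (intervalIntegral.integral_mono_interval hy.1 hyx hx.2
      (Filter.Eventually.of_forall fun _ => abs_nonneg _) hint)

/-- Local interpolation estimate: `f'` is controlled pointwise on `[a, b]` by the `L¹`-norms of `f`
and `f''`. -/
theorem abs_deriv_le_integral {f g h : ℝ → ℝ} {a b x : ℝ} (hab : a < b)
    (hf : ∀ x ∈ Icc a b, HasDerivAt f (g x) x) (hg : ∀ x ∈ Icc a b, HasDerivAt g (h x) x)
    (hh : ContinuousOn h (Icc a b)) (hx : x ∈ Icc a b) :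
    |g x| ≤ 18 / (b - a) ^ 2 * (∫ y in a..b, |f y|) + ∫ y in a..b, |h y| := by
  have hfc : ContinuousOn f (Icc a b) := fun x hx => (hf x hx).continuousAt.continuousWithinAt
  obtain ⟨y, hy, hyf⟩ := exists_abs_le_integral (c := a) (d := a + (b - a) / 3) le_rfl
    (by linarith) (by linarith) hfc
  obtain ⟨z, hz, hzf⟩ := exists_abs_le_integral (c := b - (b - a) / 3) (d := b)
    (by linarith) (by linarith) le_rfl hfc
  have hyz : (b - a) / 3 ≤ z - y := by linarith [hy.2, hz.1]
  have hsub : Icc y z ⊆ Icc a b := Icc_subset_Icc hy.1 hz.2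
  obtain ⟨c, hc, hgc⟩ := exists_hasDerivAt_eq_slope f g (show y < z by linarith) (hfc.mono hsub)
    (fun w hw => hf w (hsub (Ioo_subset_Icc_self hw)))
  set I := ∫ y in a..b, |f y| with hI
  have hgcI : |g c| ≤ 18 / (b - a) ^ 2 * I := by
    have hba : 0 < b - a := sub_pos.2 hab
    have h1 : |f y| ≤ 3 / (b - a) * I := by
      rw [div_mul_eq_mul_div, le_div_iff₀ hba]
      linarith
    have h2 : |f z| ≤ 3 / (b - a) * I := by
      rw [div_mul_eq_mul_div, le_div_iff₀ hba]
      linarith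
    rw [hgc, abs_div, abs_of_pos (show 0 < z - y by linarith)]
    calc |f z - f y| / (z - y) ≤ (3 / (b - a) * I + 3 / (b - a) * I) / ((b - a) / 3) := by
          have : |f z - f y| ≤ 3 / (b - a) * I + 3 / (b - a) * I :=
            (abs_sub _ _).trans (by linarith)
          exact div_le_div₀ ((abs_nonneg _).trans this) this (by linarith) hyz
      _ = 18 / (b - a) ^ 2 * I := by field_simp; ring
  have h3 := abs_sub_le_integral_abs_deriv hg hh hx (hsub (Ioo_subset_Icc_self hc))
  have h4 : |g x| ≤ |g x - g c| + |g c| := by simpa using abs_add_le (g x - g c) (g c)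
  linarith

/-- A radius at which the scaled `L¹`-norms of `f` and `f''` balance, provided the latter
dominates at the largest admissible scale. -/
theorem exists_balanced_radius {f g h : ℝ → ℝ} {x R : ℝ} (hR : 0 < R)
    (hf : ∀ y ∈ Icc (x - R) (x + R), HasDerivAt f (g y) y)
    (hg : ∀ y ∈ Icc (x - R) (x + R), HasDerivAt g (h y) y)
    (hh : ContinuousOn h (Icc (x - R) (x + R))) (hgx : g x ≠ 0)
    (hdom : (∫ y in (x - R)..(x + R), |f y|) < R ^ 2 * ∫ y in (x - R)..(x + R), |h y|) :
    ∃ r, 0 < r ∧ r ≤ R ∧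
      (∫ y in (x - r)..(x + r), |f y|) = r ^ 2 * ∫ y in (x - r)..(x + r), |h y| := by
  have hfc : ContinuousOn f (Icc (x - R) (x + R)) :=
    fun x hx => (hf x hx).continuousAt.continuousWithinAt
  have cont : ∀ u : ℝ → ℝ, ContinuousOn u (Icc (x - R) (x + R)) →
      ContinuousOn (fun r => ∫ y in (x - r)..(x + r), |u y|) (Icc 0 R) := by
    intro u hu
    have hint : IntervalIntegrable (fun z => |u z|) volume (x - R) (x + R) :=
      ContinuousOn.intervalIntegrable_of_Icc (by linarith) hu.abs
    have hprim := intervalIntegral.continuousOn_primitive_interval'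
      (f := fun z => |u z|) (a := x) (b₁ := x - R) (b₂ := x + R) hint
      (by rw [uIcc_of_le (by linarith)]; constructor <;> linarith)
    rw [uIcc_of_le (by linarith)] at hprim
    have h1 : ContinuousOn (fun r => ∫ y in x..(x + r), |u y|) (Icc 0 R) :=
      hprim.comp (f := fun r => x + r) (by fun_prop)
        (fun r hr => ⟨by linarith [hr.1], by linarith [hr.2]⟩)
    have h2 : ContinuousOn (fun r => ∫ y in x..(x - r), |u y|) (Icc 0 R) :=
      hprim.comp (f := fun r => x - r) (by fun_prop)
        (fun r hr => ⟨by linarith [hr.2], by linarith [hr.1]⟩)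
    refine (h1.sub h2).congr fun r hr => ?_
    refine (intervalIntegral.integral_interval_sub_left ?_ ?_).symm <;>
    · refine hint.mono_set ?_
      rw [uIcc_of_le (show x - R ≤ x + R by linarith)]
      refine uIcc_subset_Icc ⟨by linarith, by linarith⟩ ⟨?_, ?_⟩ <;> linarith [hr.1, hr.2]
  have hH : ContinuousOn (fun r => (∫ y in (x - r)..(x + r), |f y|)
      - r ^ 2 * ∫ y in (x - r)..(x + r), |h y|) (Icc 0 R) :=
    (cont f hfc).sub ((by fun_prop : ContinuousOn (fun r : ℝ => r ^ 2) _).mul (cont h hh))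
  by_cases hex : ∃ r, 0 < r ∧ r ≤ R ∧
      0 ≤ (∫ y in (x - r)..(x + r), |f y|) - r ^ 2 * ∫ y in (x - r)..(x + r), |h y|
  · obtain ⟨r, hr0, hrR, hr⟩ := hex
    obtain ⟨s, hs, hs0⟩ := intermediate_value_Icc' hrR (hH.mono (Icc_subset_Icc_left hr0.le))
      (show (0 : ℝ) ∈ Icc _ _ from ⟨by linarith, hr⟩)
    exact ⟨s, hr0.trans_le hs.1, hs.2, sub_eq_zero.1 hs0⟩
  · exfalso
    push Not at hex
    have hbound : ∀ r ∈ Ioc 0 R, |g x| ≤ 6 * ∫ y in (x - r)..(x + r), |h y| := by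
      intro r hr
      have hsub : Icc (x - r) (x + r) ⊆ Icc (x - R) (x + R) :=
        Icc_subset_Icc (by linarith [hr.2]) (by linarith [hr.2])
      have h1 := abs_deriv_le_integral (show x - r < x + r by linarith [hr.1])
        (fun y hy => hf y (hsub hy)) (fun y hy => hg y (hsub hy)) (hh.mono hsub)
        (show x ∈ Icc (x - r) (x + r) from ⟨by linarith [hr.1], by linarith [hr.1]⟩)
      have h2 := hex r hr.1 hr.2
      have hr2 : 0 < r ^ 2 := pow_pos hr.1 2
      have h3 : 18 / (x + r - (x - r)) ^ 2 * (∫ y in (x - r)..(x + r), |f y|)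
          ≤ 18 / (x + r - (x - r)) ^ 2 * (r ^ 2 * ∫ y in (x - r)..(x + r), |h y|) := by
        refine mul_le_mul_of_nonneg_left (by linarith) (by positivity)
      have h4 : 18 / (x + r - (x - r)) ^ 2 * (r ^ 2 * ∫ y in (x - r)..(x + r), |h y|)
          = 9 / 2 * ∫ y in (x - r)..(x + r), |h y| := by
        have : r ≠ 0 := hr.1.ne'
        rw [show x + r - (x - r) = 2 * r by ring]
        field_simp
        ring
      have h5 : 0 ≤ ∫ y in (x - r)..(x + r), |h y| :=
        intervalIntegral.integral_nonneg (by linarith [hr.1]) fun _ _ => abs_nonneg _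
      linarith
    have hlim : Filter.Tendsto (fun r => 6 * ∫ y in (x - r)..(x + r), |h y|)
        (nhdsWithin 0 (Ioc 0 R)) (nhds 0) := by
      have := ((cont h hh) 0 ⟨le_rfl, hR.le⟩).mono Ioc_subset_Icc_self
      simpa using (this.tendsto.const_mul 6)
    have : (nhdsWithin (0 : ℝ) (Ioc 0 R)).NeBot := by
      rw [nhdsWithin_Ioc_eq_nhdsGT hR]
      infer_instance
    have := ge_of_tendsto hlim (Filter.eventually_of_mem self_mem_nhdsWithin hbound)
    exact hgx (abs_nonpos_iff.1 this)

theorem rpow_le_two_rpow_abs_mul_rpow {x y : ℝ} (σ : ℝ) (hx : 0 < x) (h1 : x / 2 ≤ y)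
    (h2 : y ≤ 2 * x) : y ^ σ ≤ 2 ^ |σ| * x ^ σ := by
  have hy : 0 < y := by linarith
  rw [← div_le_iff₀ (Real.rpow_pos_of_pos hx σ), ← Real.div_rpow hy.le hx.le]
  rcases le_total 0 σ with hσ | hσ
  · rw [abs_of_nonneg hσ]
    exact Real.rpow_le_rpow (by positivity) (by rwa [div_le_iff₀ hx]) hσ
  · rw [abs_of_nonpos hσ, Real.rpow_neg zero_le_two, ← Real.inv_rpow zero_le_two]
    refine Real.rpow_le_rpow_of_nonpos (by norm_num) ?_ hσ
    rw [le_div_iff₀ hx]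
    linarith

/-- Hölder's inequality with power weights on an interval comparable to its centre. -/
theorem integral_abs_le_weighted_eLpNorm {u : ℝ → ℝ} {x r σ : ℝ} {p : ℝ≥0∞} (hp : 1 ≤ p)
    (hr : 0 < r) (hrx : r ≤ x / 2) (hu : ContinuousOn u (Icc (x - r) (x + r)))
    (hfin : eLpNorm (fun y => y ^ σ * u y) p (volume.restrict (Icc (x - r) (x + r))) ≠ ⊤) :
    (∫ y in (x - r)..(x + r), |u y|) ≤ 2 * 2 ^ |σ| * r ^ (1 - (1 / p).toReal) * x ^ (-σ) *
      (eLpNorm (fun y => y ^ σ * u y) p (volume.restrict (Icc (x - r) (x + r)))).toReal := by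
  have hx : 0 < x := by linarith
  set μ := volume.restrict (Icc (x - r) (x + r)) with hμ
  set N := eLpNorm (fun y => y ^ σ * u y) p μ with hN
  have hmeas : AEStronglyMeasurable u μ := hu.aestronglyMeasurable measurableSet_Icc
  have hint : Integrable u μ := hu.integrableOn_Icc
  have h1 : eLpNorm u p μ ≤ ENNReal.ofReal (2 ^ |σ| * x ^ (-σ)) * N := by
    refine eLpNorm_le_mul_eLpNorm_of_ae_le_mul ?_ p
    filter_upwards [ae_restrict_mem measurableSet_Icc] with y hy
    have hy0 : 0 < y := by linarith [hy.1]
    have := rpow_le_two_rpow_abs_mul_rpow σ hy0 (show y / 2 ≤ x by linarith [hy.2])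
      (by linarith [hy.1])
    rw [norm_mul, Real.norm_of_nonneg (Real.rpow_nonneg hy0.le σ), Real.rpow_neg hx.le,
      ← mul_assoc]
    refine le_mul_of_one_le_left (norm_nonneg _) ?_
    rw [mul_right_comm, ← div_eq_mul_inv, one_le_div (Real.rpow_pos_of_pos hx σ)]
    exact this
  have h2 := eLpNorm_le_eLpNorm_mul_rpow_measure_univ (μ := μ) hp hmeas
  have huniv : μ univ = ENNReal.ofReal (2 * r) := by
    rw [hμ, Measure.restrict_apply_univ, Real.volume_Icc]
    congr 1
    ring
  have ha : 0 ≤ 1 / p.toReal ∧ 1 / p.toReal ≤ 1 := by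
    refine ⟨by positivity, ?_⟩
    rcases eq_or_ne p ⊤ with rfl | hpt
    · simp
    · have : 1 ≤ p.toReal := by simpa using (ENNReal.toReal_le_toReal (by simp) hpt).2 hp
      exact div_le_one_of_le₀ this (by linarith)
  have hap : (1 / p).toReal = 1 / p.toReal := by simp
  rw [huniv, eLpNorm_one_eq_lintegral_enorm, ← ofReal_integral_norm_eq_lintegral_enorm hint,
    ENNReal.toReal_one, div_one, ENNReal.ofReal_rpow_of_nonneg (by positivity) (by linarith)] at h2
  have h3 : ENNReal.ofReal (∫ y, ‖u y‖ ∂μ) ≤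
      ENNReal.ofReal (2 ^ |σ| * x ^ (-σ)) * N * ENNReal.ofReal ((2 * r) ^ (1 - 1 / p.toReal)) :=
    h2.trans (by gcongr)
  have h4 := ENNReal.toReal_mono (by finiteness) h3
  have hx' := Real.rpow_nonneg hx.le (-σ)
  rw [ENNReal.toReal_ofReal (integral_nonneg fun _ => norm_nonneg _), ENNReal.toReal_mul,
    ENNReal.toReal_mul, ENNReal.toReal_ofReal (by positivity),
    ENNReal.toReal_ofReal (by positivity)] at h4
  rw [intervalIntegral.integral_of_le (by linarith), ← integral_Icc_eq_integral_Ioc, hap]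
  refine h4.trans ?_
  have h5 : (2 * r) ^ (1 - 1 / p.toReal) ≤ 2 * r ^ (1 - 1 / p.toReal) := by
    rw [Real.mul_rpow zero_le_two hr.le]
    refine mul_le_mul_of_nonneg_right ?_ (by positivity)
    calc (2 : ℝ) ^ (1 - 1 / p.toReal) ≤ 2 ^ (1 : ℝ) :=
          Real.rpow_le_rpow_of_exponent_le one_le_two (by linarith)
      _ = 2 := Real.rpow_one 2
  calc 2 ^ |σ| * x ^ (-σ) * N.toReal * (2 * r) ^ (1 - 1 / p.toReal)
      ≤ 2 ^ |σ| * x ^ (-σ) * N.toReal * (2 * r ^ (1 - 1 / p.toReal)) := by gcongr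
    _ = _ := by ring

theorem exists_eLpNorm_rpow_Ioc_le {s : ℝ} {q : ℝ≥0∞} (hq : 1 ≤ q) (hs : 0 < s + (1 / q).toReal) :
    ∃ C : ℝ, 0 ≤ C ∧ ∀ R : ℝ, 0 < R →
      eLpNorm (fun y : ℝ => y ^ s) q (volume.restrict (Ioc 0 R)) ≤
        ENNReal.ofReal (C * R ^ (s + (1 / q).toReal)) := by
  rcases eq_or_ne q ⊤ with rfl | hqt
  · refine ⟨1, zero_le_one, fun R hR => ?_⟩
    rw [eLpNorm_exponent_top]
    refine eLpNormEssSup_le_of_ae_bound ?_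
    filter_upwards [ae_restrict_mem measurableSet_Ioc] with y hy
    simp only [one_div, ENNReal.inv_top, ENNReal.toReal_zero, add_zero] at hs ⊢
    rw [Real.norm_of_nonneg (Real.rpow_nonneg hy.1.le s), one_mul]
    exact Real.rpow_le_rpow hy.1.le hy.2 hs.le
  · have hQ : 1 ≤ q.toReal := by simpa using (ENNReal.toReal_le_toReal (by simp) hqt).2 hq
    have hQ0 : 0 < q.toReal := by linarith
    have hinv : (1 / q).toReal = 1 / q.toReal := by simp
    have hs' : 0 < s * q.toReal + 1 := by
      have : s * q.toReal + 1 = (s + 1 / q.toReal) * q.toReal := by field_simp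
      rw [this, ← hinv]
      positivity
    refine ⟨(1 / (s * q.toReal + 1)) ^ (1 / q.toReal), by positivity, fun R hR => ?_⟩
    rw [eLpNorm_eq_lintegral_rpow_enorm_toReal (by positivity) hqt]
    have h1 : ∫⁻ y in Ioc 0 R, ‖y ^ s‖ₑ ^ q.toReal =
        ENNReal.ofReal (R ^ (s * q.toReal + 1) / (s * q.toReal + 1)) := by
      have h2 : ∫⁻ y in Ioc 0 R, ‖y ^ s‖ₑ ^ q.toReal =
          ∫⁻ y in Ioc 0 R, ENNReal.ofReal (y ^ (s * q.toReal)) := by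
        refine setLIntegral_congr_fun measurableSet_Ioc fun y hy => ?_
        have := Real.rpow_nonneg hy.1.le s
        rw [Real.enorm_of_nonneg this, ENNReal.ofReal_rpow_of_nonneg this hQ0.le,
          Real.rpow_mul hy.1.le]
      have hI : IntegrableOn (fun y : ℝ => y ^ (s * q.toReal)) (Ioc 0 R) := by
        rw [← intervalIntegrable_iff_integrableOn_Ioc_of_le hR.le]
        exact intervalIntegral.intervalIntegrable_rpow' (by linarith)
      rw [h2, ← ofReal_integral_eq_lintegral_ofReal hI, ← intervalIntegral.integral_of_le hR.le,
        integral_rpow (Or.inl (by linarith)), Real.zero_rpow hs'.ne', sub_zero]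
      filter_upwards [ae_restrict_mem measurableSet_Ioc] with y hy
      exact Real.rpow_nonneg hy.1.le _
    rw [h1, ENNReal.ofReal_rpow_of_nonneg (by positivity) (by positivity)]
    refine le_of_eq (congrArg _ ?_)
    rw [div_eq_mul_one_div, Real.mul_rpow (by positivity) (by positivity), ← Real.rpow_mul hR.le,
      mul_comm, hinv]
    congr 2
    field_simp

theorem exists_eLpNorm_rpow_Ioi_le {s : ℝ} {q : ℝ≥0∞} (hq : 1 ≤ q) (hqt : q ≠ ⊤)
    (hs : s + (1 / q).toReal < 0) :
    ∃ C : ℝ, 0 ≤ C ∧ ∀ R : ℝ, 0 < R →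
      eLpNorm (fun y : ℝ => y ^ s) q (volume.restrict (Ioi R)) ≤
        ENNReal.ofReal (C * R ^ (s + (1 / q).toReal)) := by
  have hQ : 1 ≤ q.toReal := by simpa using (ENNReal.toReal_le_toReal (by simp) hqt).2 hq
  have hQ0 : 0 < q.toReal := by linarith
  have hinv : (1 / q).toReal = 1 / q.toReal := by simp
  have hs' : s * q.toReal + 1 < 0 := by
    have : s * q.toReal + 1 = (s + 1 / q.toReal) * q.toReal := by field_simp
    rw [this, ← hinv]
    exact mul_neg_of_neg_of_pos hs hQ0
  have hs'' : 0 < -(s * q.toReal + 1) := by linarith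
  refine ⟨(1 / -(s * q.toReal + 1)) ^ (1 / q.toReal), by positivity, fun R hR => ?_⟩
  rw [eLpNorm_eq_lintegral_rpow_enorm_toReal (by positivity) hqt]
  have h1 : ∫⁻ y in Ioi R, ‖y ^ s‖ₑ ^ q.toReal =
      ENNReal.ofReal (R ^ (s * q.toReal + 1) / -(s * q.toReal + 1)) := by
    have h2 : ∫⁻ y in Ioi R, ‖y ^ s‖ₑ ^ q.toReal =
        ∫⁻ y in Ioi R, ENNReal.ofReal (y ^ (s * q.toReal)) := by
      refine setLIntegral_congr_fun measurableSet_Ioi fun y hy => ?_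
      have hy0 : 0 < y := hR.trans hy
      have := Real.rpow_nonneg hy0.le s
      rw [Real.enorm_of_nonneg this, ENNReal.ofReal_rpow_of_nonneg this hQ0.le,
        Real.rpow_mul hy0.le]
    rw [h2, ← ofReal_integral_eq_lintegral_ofReal
      (integrableOn_Ioi_rpow_of_lt (by linarith) hR), integral_Ioi_rpow_of_lt (by linarith) hR,
      neg_div, div_neg]
    filter_upwards [ae_restrict_mem measurableSet_Ioi] with y hy
    exact Real.rpow_nonneg (hR.le.trans (le_of_lt hy)) _
  rw [h1, ENNReal.ofReal_rpow_of_nonneg (by positivity) (by positivity)]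
  refine le_of_eq (congrArg _ ?_)
  rw [div_eq_mul_one_div, Real.mul_rpow (by positivity) (by positivity), ← Real.rpow_mul hR.le,
    mul_comm, hinv]
  congr 2
  field_simp

/-- Hölder's inequality for sums of local `Lᵖ`-norms over disjoint sets. -/
theorem sum_eLpNorm_mul_eLpNorm_rpow_le {α ι : Type*} [MeasurableSpace α] {μ : Measure α}
    {p₀ p₂ p₁ : ℝ≥0∞} (hp₀ : 1 ≤ p₀) (hp₂ : 1 ≤ p₂) (hp₁ : 1 ≤ p₁) (hp₁top : p₁ ≠ ⊤)
    (hrel : 1 / p₂ + 1 / p₀ = 2 / p₁) (u v : α → ℝ) (s : Finset ι) {E : ι → Set α}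
    (hE : ∀ i ∈ s, MeasurableSet (E i)) (hdisj : (s : Set ι).PairwiseDisjoint E) :
    ∑ i ∈ s, (eLpNorm u p₀ (μ.restrict (E i)) * eLpNorm v p₂ (μ.restrict (E i))) ^
        (p₁.toReal / 2) ≤ (eLpNorm u p₀ μ * eLpNorm v p₂ μ) ^ (p₁.toReal / 2) := by
  have hP : 1 ≤ p₁.toReal := by simpa using (ENNReal.toReal_le_toReal (by simp) hp₁top).2 hp₁
  have hP0 : 0 < p₁.toReal / 2 := by linarith
  have pow_eq : ∀ (w : α → ℝ) (p : ℝ≥0∞), 1 ≤ p → p ≠ ⊤ → ∀ ν : Measure α,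
      eLpNorm w p ν ^ p.toReal = ∫⁻ x, ‖w x‖ₑ ^ p.toReal ∂ν := by
    intro w p hp hpt ν
    have : 0 < p.toReal := ENNReal.toReal_pos (by positivity) hpt
    rw [eLpNorm_eq_lintegral_rpow_enorm_toReal (by positivity) hpt, ← ENNReal.rpow_mul,
      one_div_mul_cancel this.ne', ENNReal.rpow_one]
  have sum_le : ∀ (w : α → ℝ) (p : ℝ≥0∞), 1 ≤ p → p ≠ ⊤ →
      ∑ i ∈ s, eLpNorm w p (μ.restrict (E i)) ^ p.toReal ≤ eLpNorm w p μ ^ p.toReal := by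
    intro w p hp hpt
    simp only [pow_eq w p hp hpt]
    rw [← lintegral_biUnion_finset hdisj hE]
    exact setLIntegral_le_lintegral _ _
  have one_top : ∀ (w z : α → ℝ) (p : ℝ≥0∞), 1 ≤ p → p ≠ ⊤ → p.toReal = p₁.toReal / 2 →
      ∑ i ∈ s, (eLpNorm w ⊤ (μ.restrict (E i)) * eLpNorm z p (μ.restrict (E i))) ^
        (p₁.toReal / 2) ≤ (eLpNorm w ⊤ μ * eLpNorm z p μ) ^ (p₁.toReal / 2) := by
    intro w z p hp hpt hpp
    simp only [ENNReal.mul_rpow_of_nonneg _ _ hP0.le]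
    calc _ ≤ ∑ i ∈ s, eLpNorm w ⊤ μ ^ (p₁.toReal / 2) *
              eLpNorm z p (μ.restrict (E i)) ^ (p₁.toReal / 2) := by
          gcongr with i hi
          exact Measure.restrict_le_self
      _ ≤ _ := by
          rw [← Finset.mul_sum, ← hpp]
          gcongr
          exact sum_le z p hp hpt
  have hrel' := congrArg ENNReal.toReal hrel
  rw [ENNReal.toReal_add (by simp; positivity) (by simp; positivity)] at hrel'
  simp only [one_div, ENNReal.toReal_inv, ENNReal.toReal_div, ENNReal.toReal_ofNat] at hrel'
  rcases eq_or_ne p₀ ⊤ with rfl | h0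
  · rcases eq_or_ne p₂ ⊤ with rfl | h2
    · have : 0 < 2 / p₁.toReal := by positivity
      simp at hrel'
      linarith
    · refine one_top u v p₂ hp₂ h2 ?_
      simp only [ENNReal.toReal_top, inv_zero, add_zero] at hrel'
      rw [← inv_inv p₂.toReal, hrel', inv_div]
  rcases eq_or_ne p₂ ⊤ with rfl | h2
  · simp only [mul_comm (eLpNorm u _ _)]
    refine one_top v u p₀ hp₀ h0 ?_
    simp only [ENNReal.toReal_top, inv_zero, zero_add] at hrel'
    rw [← inv_inv p₀.toReal, hrel', inv_div]
  have hP0' : 0 < p₀.toReal := ENNReal.toReal_pos (by positivity) h0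
  have hP2' : 0 < p₂.toReal := ENNReal.toReal_pos (by positivity) h2
  have hconj : (p₀.toReal / (p₁.toReal / 2)).HolderConjugate (p₂.toReal / (p₁.toReal / 2)) := by
    refine ⟨?_, by positivity, by positivity⟩
    have : (p₀.toReal / (p₁.toReal / 2))⁻¹ + (p₂.toReal / (p₁.toReal / 2))⁻¹ =
        p₁.toReal / 2 * (p₂.toReal⁻¹ + p₀.toReal⁻¹) := by
      rw [inv_div, inv_div]
      ring
    rw [this, hrel']
    field_simp
  have key := ENNReal.inner_le_Lp_mul_Lq s
    (fun i => eLpNorm u p₀ (μ.restrict (E i)) ^ (p₁.toReal / 2))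
    (fun i => eLpNorm v p₂ (μ.restrict (E i)) ^ (p₁.toReal / 2)) hconj
  simp only [ENNReal.mul_rpow_of_nonneg _ _ hP0.le]
  refine key.trans ?_
  simp only [← ENNReal.rpow_mul, mul_div_cancel₀ _ hP0.ne', one_div_div]
  have fin : ∀ (w : α → ℝ) (p : ℝ≥0∞), 1 ≤ p → p ≠ ⊤ → 0 < p.toReal →
      (∑ i ∈ s, eLpNorm w p (μ.restrict (E i)) ^ p.toReal) ^ (p₁.toReal / 2 / p.toReal) ≤
        eLpNorm w p μ ^ (p₁.toReal / 2) := by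
    intro w p hp hpt hpp
    calc _ ≤ (eLpNorm w p μ ^ p.toReal) ^ (p₁.toReal / 2 / p.toReal) := by
          gcongr
          exact sum_le w p hp hpt
      _ = _ := by rw [← ENNReal.rpow_mul, mul_div_cancel₀ _ hpp.ne']
  exact mul_le_mul' (fin u p₀ hp₀ h0 hP0') (fin v p₂ hp₂ h2 hP2')

theorem eLpNorm_restrict_union_le {α : Type*} [MeasurableSpace α] {μ : Measure α} {p : ℝ≥0∞}
    (hp : 1 ≤ p) (hpt : p ≠ ⊤) (u : α → ℝ) (s t : Set α) :
    eLpNorm u p (μ.restrict (s ∪ t)) ≤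
      eLpNorm u p (μ.restrict s) + eLpNorm u p (μ.restrict t) := by
  have hP : 1 ≤ p.toReal := by simpa using (ENNReal.toReal_le_toReal (by simp) hpt).2 hp
  simp only [eLpNorm_eq_lintegral_rpow_enorm_toReal (show p ≠ 0 by positivity) hpt]
  calc _ ≤ (∫⁻ x in s, ‖u x‖ₑ ^ p.toReal ∂μ + ∫⁻ x in t, ‖u x‖ₑ ^ p.toReal ∂μ) ^
        (1 / p.toReal) := by
        gcongr
        exact lintegral_union_le _ _ _
    _ ≤ _ := ENNReal.rpow_add_le_add_rpow _ _ (by positivity)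
        (div_le_one_of_le₀ hP (by linarith))

/-- Bound for the local `L¹`-norm at scale `x` by the global weighted norm. -/
theorem integral_abs_half_le_wLp {u : ℝ → ℝ} {x σ : ℝ} {p : ℝ≥0∞} (hp : 1 ≤ p) (hx : 0 < x)
    (hu : ContinuousOn u (Ioi 0)) (hfin : wLp σ p u < ⊤) :
    (∫ y in (x - x / 2)..(x + x / 2), |u y|) ≤
      2 * 2 ^ |σ| * x ^ (1 - (σ + (1 / p).toReal)) * (wLp σ p u).toReal := by
  have hsub : Icc (x - x / 2) (x + x / 2) ⊆ Ioi 0 := fun y hy => by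
    have := hy.1
    simp only [mem_Ioi]
    linarith
  have hle : eLpNorm (fun y => y ^ σ * u y) p
      (volume.restrict (Icc (x - x / 2) (x + x / 2))) ≤ wLp σ p u :=
    eLpNorm_mono_measure _ (Measure.restrict_mono_set _ hsub)
  have h1 := integral_abs_le_weighted_eLpNorm (σ := σ) hp (half_pos hx) le_rfl (hu.mono hsub)
    (hle.trans_lt hfin).ne
  have ha : (1 / p).toReal ≤ 1 := by
    simpa using ENNReal.toReal_mono ENNReal.one_ne_top (ENNReal.inv_le_one.2 hp)
  have hx' := Real.rpow_nonneg hx.le (-σ)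
  calc _ ≤ 2 * 2 ^ |σ| * x ^ (1 - (1 / p).toReal) * x ^ (-σ) * (wLp σ p u).toReal := by
        refine h1.trans ?_
        gcongr
        · linarith
        · exact hfin.ne
    _ = _ := by
        rw [mul_assoc (2 * 2 ^ |σ|), ← Real.rpow_add hx]
        congr 3
        ring

theorem abs_deriv_le_integral_half {f g h : ℝ → ℝ} {x : ℝ} (hx : 0 < x)
    (hf : ∀ x, 0 < x → HasDerivAt f (g x) x) (hg : ∀ x, 0 < x → HasDerivAt g (h x) x)
    (hh : ContinuousOn h (Ioi 0)) :
    |g x| ≤ 18 / x ^ 2 * (∫ y in (x - x / 2)..(x + x / 2), |f y|) +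
      ∫ y in (x - x / 2)..(x + x / 2), |h y| := by
  have hpos : ∀ y ∈ Icc (x - x / 2) (x + x / 2), 0 < y := fun y hy => by linarith [hy.1]
  have := abs_deriv_le_integral (show x - x / 2 < x + x / 2 by linarith)
    (fun y hy => hf y (hpos y hy)) (fun y hy => hg y (hpos y hy)) (hh.mono hpos)
    (show x ∈ Icc (x - x / 2) (x + x / 2) from ⟨by linarith, by linarith⟩)
  rwa [show x + x / 2 - (x - x / 2) = x by ring] at this

theorem abs_deriv_le_wLp {f g h : ℝ → ℝ} {p₀ p₂ : ℝ≥0∞} {σ₀ σ₂ x : ℝ} (hp₀ : 1 ≤ p₀)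
    (hp₂ : 1 ≤ p₂) (hf : ∀ x, 0 < x → HasDerivAt f (g x) x)
    (hg : ∀ x, 0 < x → HasDerivAt g (h x) x) (hh : ContinuousOn h (Ioi 0))
    (hA : wLp σ₀ p₀ f < ⊤) (hB : wLp σ₂ p₂ h < ⊤) (hx : 0 < x) :
    |g x| ≤ 36 * 2 ^ |σ₀| * x ^ (-1 - (σ₀ + (1 / p₀).toReal)) * (wLp σ₀ p₀ f).toReal +
      2 * 2 ^ |σ₂| * x ^ (1 - (σ₂ + (1 / p₂).toReal)) * (wLp σ₂ p₂ h).toReal := by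
  have hfc : ContinuousOn f (Ioi 0) := fun x hx => (hf x hx).continuousAt.continuousWithinAt
  have h1 := integral_abs_half_le_wLp hp₀ hx hfc hA
  refine (abs_deriv_le_integral_half hx hf hg hh).trans
    (add_le_add ?_ (integral_abs_half_le_wLp hp₂ hx hh hB))
  calc _ ≤ 18 / x ^ 2 * _ := mul_le_mul_of_nonneg_left h1 (by positivity)
    _ = _ := by
      rw [show 1 - (σ₀ + (1 / p₀).toReal) = -1 - (σ₀ + (1 / p₀).toReal) + 2 by ring,
        Real.rpow_add hx, Real.rpow_two]
      field_simp
      ring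

/-- At points where `f` dominates at scale `x`, the derivative is controlled by `f` alone. -/
theorem abs_deriv_le_wLp_of_dominated {f g h : ℝ → ℝ} {p₀ : ℝ≥0∞} {σ₀ x : ℝ} (hp₀ : 1 ≤ p₀)
    (hf : ∀ x, 0 < x → HasDerivAt f (g x) x)
    (hg : ∀ x, 0 < x → HasDerivAt g (h x) x) (hh : ContinuousOn h (Ioi 0))
    (hA : wLp σ₀ p₀ f < ⊤) (hx : 0 < x)
    (hdom : (x / 2) ^ 2 * (∫ y in (x - x / 2)..(x + x / 2), |h y|) ≤
      ∫ y in (x - x / 2)..(x + x / 2), |f y|) :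
    |g x| ≤ 44 * 2 ^ |σ₀| * x ^ (-1 - (σ₀ + (1 / p₀).toReal)) * (wLp σ₀ p₀ f).toReal := by
  have hfc : ContinuousOn f (Ioi 0) := fun x hx => (hf x hx).continuousAt.continuousWithinAt
  have h1 := integral_abs_half_le_wLp hp₀ hx hfc hA
  have h2 : (∫ y in (x - x / 2)..(x + x / 2), |h y|) ≤
      4 / x ^ 2 * ∫ y in (x - x / 2)..(x + x / 2), |f y| := by
    rw [div_mul_eq_mul_div, le_div_iff₀ (by positivity)]
    linarith
  calc |g x| ≤ 22 / x ^ 2 * ∫ y in (x - x / 2)..(x + x / 2), |f y| := by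
        have h3 := abs_deriv_le_integral_half hx hf hg hh
        have h4 : 22 / x ^ 2 * (∫ y in (x - x / 2)..(x + x / 2), |f y|) =
            18 / x ^ 2 * (∫ y in (x - x / 2)..(x + x / 2), |f y|) +
            4 / x ^ 2 * (∫ y in (x - x / 2)..(x + x / 2), |f y|) := by ring
        linarith
    _ ≤ 22 / x ^ 2 * _ := mul_le_mul_of_nonneg_left h1 (by positivity)
    _ = _ := by
      rw [show 1 - (σ₀ + (1 / p₀).toReal) = -1 - (σ₀ + (1 / p₀).toReal) + 2 by ring,
        Real.rpow_add hx, Real.rpow_two]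
      field_simp
      ring

/-- Hardy-type bound for the tail integral of `h`. -/
theorem exists_integral_abs_le_rpow_mul_wLp {p : ℝ≥0∞} {σ t : ℝ} (hp : 1 ≤ p) (ht : 0 ≤ t)
    (hst : 0 < 1 - (σ + (1 / p).toReal) + t) :
    ∃ C : ℝ, 0 ≤ C ∧ ∀ h : ℝ → ℝ, ContinuousOn h (Ioi 0) → wLp σ p h < ⊤ →
      ∀ x R : ℝ, 0 < x → x ≤ R → (∫ y in x..R, |h y|) ≤
        C * x ^ (-t) * R ^ (1 - (σ + (1 / p).toReal) + t) * (wLp σ p h).toReal := by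
  have hpq : p.HolderConjugate p.conjExponent := .conjExponent hp
  set q := p.conjExponent with hq
  have hq1 : 1 ≤ q := by simp [hq, ENNReal.conjExponent]
  have ha : (1 / q).toReal = 1 - (1 / p).toReal := by
    have := congrArg ENNReal.toReal (ENNReal.HolderConjugate.inv_add_inv_eq_one p q)
    rw [ENNReal.toReal_add (by simp; positivity) (by simp; positivity)] at this
    simp only [one_div]
    simp at this ⊢
    linarith
  obtain ⟨C, hC, hCR⟩ := exists_eLpNorm_rpow_Ioc_le (s := t - σ) hq1 (by rw [ha]; linarith)
  refine ⟨C, hC, fun h hh hB x R hx hxR => ?_⟩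
  have hR : 0 < R := hx.trans_le hxR
  have hint : IntegrableOn h (Ioc x R) :=
    (hh.mono (fun y hy => hx.trans_le hy.1) : ContinuousOn h (Icc x R)).integrableOn_Icc.mono_set
      Ioc_subset_Icc_self
  have h1 : ENNReal.ofReal (∫ y in x..R, |h y|) ≤
      ENNReal.ofReal (x ^ (-t)) * (ENNReal.ofReal (C * R ^ (t - σ + (1 / q).toReal)) *
        wLp σ p h) := by
    rw [intervalIntegral.integral_of_le hxR]
    refine (ofReal_integral_norm_eq_lintegral_enorm hint).trans_le ?_
    rw [← eLpNorm_one_eq_lintegral_enorm]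
    calc eLpNorm h 1 (volume.restrict (Ioc x R))
        ≤ ENNReal.ofReal (x ^ (-t)) *
          eLpNorm ((fun y : ℝ => y ^ (t - σ)) • fun y => y ^ σ * h y) 1
            (volume.restrict (Ioc x R)) := by
          refine eLpNorm_le_mul_eLpNorm_of_ae_le_mul ?_ 1
          filter_upwards [ae_restrict_mem measurableSet_Ioc] with y hy
          have hy0 : 0 < y := hx.trans hy.1
          simp only [Pi.smul_apply', smul_eq_mul]
          rw [← mul_assoc, ← Real.rpow_add hy0, norm_mul,
            Real.norm_of_nonneg (Real.rpow_nonneg hy0.le _), ← mul_assoc,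
            show t - σ + σ = t by ring]
          refine le_mul_of_one_le_left (norm_nonneg _) ?_
          rw [Real.rpow_neg hx.le, inv_mul_eq_div, one_le_div (Real.rpow_pos_of_pos hx t)]
          exact Real.rpow_le_rpow hx.le hy.1.le ht
      _ ≤ ENNReal.ofReal (x ^ (-t)) *
          eLpNorm ((fun y : ℝ => y ^ (t - σ)) • fun y => y ^ σ * h y) 1
            (volume.restrict (Ioc 0 R)) := by
          gcongr
      _ ≤ _ := by
          gcongr
          have hm : ∀ s : ℝ, ContinuousOn (fun y : ℝ => y ^ s) (Ioc 0 R) := fun s y hy =>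
            (Real.continuousAt_rpow_const y s (Or.inl hy.1.ne')).continuousWithinAt
          have : q.HolderTriple p 1 := hpq.symm
          refine (eLpNorm_smul_le_mul_eLpNorm (p := q) (q := p)
            (((hm σ).mul (hh.mono Ioc_subset_Ioi_self)).aestronglyMeasurable measurableSet_Ioc)
            ((hm (t - σ)).aestronglyMeasurable measurableSet_Ioc)).trans ?_
          exact mul_le_mul' (hCR R hR)
            (eLpNorm_mono_measure _ (Measure.restrict_mono_set _ Ioc_subset_Ioi_self))
  have h2 := ENNReal.toReal_mono (by finiteness) h1
  rw [ENNReal.toReal_ofReal (intervalIntegral.integral_nonneg hxR fun _ _ => abs_nonneg _),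
    ENNReal.toReal_mul, ENNReal.toReal_mul, ENNReal.toReal_ofReal (Real.rpow_nonneg hx.le _),
    ENNReal.toReal_ofReal (by positivity), ha] at h2
  refine h2.trans (le_of_eq ?_)
  rw [show t - σ + (1 - (1 / p).toReal) = 1 - (σ + (1 / p).toReal) + t by ring]
  ring

/-- Weighted estimate for `f'` on the interval `(0, R]`. -/
theorem exists_eLpNorm_Ioc_le {p₀ p₂ p₁ : ℝ≥0∞} {σ₀ σ₁ σ₂ : ℝ}
    (hp₀ : 1 ≤ p₀) (hp₂ : 1 ≤ p₂) (hp₁ : 1 ≤ p₁)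
    (h1 : 0 < σ₁ + (1 / p₁).toReal)
    (h12 : (σ₂ + (1 / p₂).toReal) - (σ₁ + (1 / p₁).toReal) < 1) :
    ∃ C : ℝ, 0 ≤ C ∧ ∀ f g h : ℝ → ℝ, (∀ x, 0 < x → HasDerivAt f (g x) x) →
      (∀ x, 0 < x → HasDerivAt g (h x) x) → ContinuousOn h (Ioi 0) →
      wLp σ₀ p₀ f < ⊤ → wLp σ₂ p₂ h < ⊤ → ∀ R : ℝ, 0 < R →
      eLpNorm (fun x => x ^ σ₁ * g x) p₁ (volume.restrict (Ioc 0 R)) ≤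
        ENNReal.ofReal (C *
          (R ^ (σ₁ + (1 / p₁).toReal - 1 - (σ₀ + (1 / p₀).toReal)) * (wLp σ₀ p₀ f).toReal +
           R ^ (1 + (σ₁ + (1 / p₁).toReal) - (σ₂ + (1 / p₂).toReal)) *
            (wLp σ₂ p₂ h).toReal)) := by
  set θ₀ := σ₀ + (1 / p₀).toReal
  set θ₁ := σ₁ + (1 / p₁).toReal with hθ₁
  set θ₂ := σ₂ + (1 / p₂).toReal with hθ₂
  obtain ⟨t, ht, htθ⟩ : ∃ t, max 0 (θ₂ - 1) < t ∧ t < θ₁ :=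
    exists_between (max_lt h1 (by linarith))
  have ht0 : 0 < t := (le_max_left _ _).trans_lt ht
  have ht2 : 0 < 1 - θ₂ + t := by linarith [(le_max_right 0 (θ₂ - 1)).trans_lt ht]
  obtain ⟨C, hC, hCh⟩ := exists_integral_abs_le_rpow_mul_wLp (σ := σ₂) hp₂ ht0.le ht2
  obtain ⟨D, hD, hDR⟩ := exists_eLpNorm_rpow_Ioc_le (s := σ₁ - t) hp₁ (by linarith)
  refine ⟨D * (36 * 2 ^ |σ₀| + 2 * 2 ^ |σ₂| + C), by positivity,
    fun f g h hf hg hh hA hB R hR => ?_⟩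
  set A := (wLp σ₀ p₀ f).toReal
  set B := (wLp σ₂ p₂ h).toReal
  have hA0 : 0 ≤ A := ENNReal.toReal_nonneg
  have hB0 : 0 ≤ B := ENNReal.toReal_nonneg
  have hgR : |g R| ≤ 36 * 2 ^ |σ₀| * R ^ (-1 - θ₀) * A + 2 * 2 ^ |σ₂| * R ^ (1 - θ₂) * B :=
    abs_deriv_le_wLp hp₀ hp₂ hf hg hh hA hB hR
  set M := R ^ t * |g R| + C * R ^ (1 - θ₂ + t) * B with hM
  have hM0 : 0 ≤ M := by positivity
  have hpt : ∀ x ∈ Ioc 0 R, |g x| ≤ M * x ^ (-t) := by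
    intro x hx
    have h2 := abs_sub_le_integral_abs_deriv (a := x) (b := R)
      (fun y hy => hg y (hx.1.trans_le hy.1)) (hh.mono fun y hy => hx.1.trans_le hy.1)
      (left_mem_Icc.2 hx.2) (right_mem_Icc.2 hx.2)
    have h3 := hCh h hh hB x R hx.1 hx.2
    have h4 : |g x| ≤ |g x - g R| + |g R| := by simpa using abs_add_le (g x - g R) (g R)
    have h5 : |g R| ≤ R ^ t * x ^ (-t) * |g R| := by
      refine le_mul_of_one_le_left (abs_nonneg _) ?_
      rw [Real.rpow_neg hx.1.le, ← div_eq_mul_inv, one_le_div (Real.rpow_pos_of_pos hx.1 t)]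
      exact Real.rpow_le_rpow hx.1.le hx.2 ht0.le
    calc |g x| ≤ C * x ^ (-t) * R ^ (1 - θ₂ + t) * B + R ^ t * x ^ (-t) * |g R| := by linarith
      _ = _ := by ring
  calc eLpNorm (fun x => x ^ σ₁ * g x) p₁ (volume.restrict (Ioc 0 R))
      ≤ ENNReal.ofReal M * eLpNorm (fun x : ℝ => x ^ (σ₁ - t)) p₁ (volume.restrict (Ioc 0 R)) := by
        refine eLpNorm_le_mul_eLpNorm_of_ae_le_mul ?_ p₁
        filter_upwards [ae_restrict_mem measurableSet_Ioc] with x hx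
        have hxσ := Real.rpow_nonneg hx.1.le σ₁
        rw [norm_mul, Real.norm_of_nonneg hxσ,
          Real.norm_of_nonneg (Real.rpow_nonneg hx.1.le _), Real.norm_eq_abs, sub_eq_add_neg,
          Real.rpow_add hx.1]
        calc x ^ σ₁ * |g x| ≤ x ^ σ₁ * (M * x ^ (-t)) :=
              mul_le_mul_of_nonneg_left (hpt x hx) hxσ
          _ = _ := by ring
    _ ≤ ENNReal.ofReal M * ENNReal.ofReal (D * R ^ (σ₁ - t + (1 / p₁).toReal)) := by
        gcongr
        exact hDR R hR
    _ ≤ _ := by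
        rw [← ENNReal.ofReal_mul hM0]
        refine ENNReal.ofReal_le_ofReal ?_
        rw [show σ₁ - t + (1 / p₁).toReal = θ₁ - t by rw [hθ₁]; ring]
        have e1 : M * (D * R ^ (θ₁ - t)) =
            D * (R ^ θ₁ * |g R| + C * R ^ (1 + θ₁ - θ₂) * B) := by
          rw [hM, show 1 - θ₂ + t = (1 + θ₁ - θ₂) - (θ₁ - t) by ring,
            Real.rpow_sub hR _ (θ₁ - t), Real.rpow_sub hR θ₁ t]
          have := (Real.rpow_pos_of_pos hR t).ne'
          have := (Real.rpow_pos_of_pos hR θ₁).ne'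
          field_simp
        have e2 : R ^ θ₁ * |g R| ≤ 36 * 2 ^ |σ₀| * (R ^ (θ₁ - 1 - θ₀) * A) +
            2 * 2 ^ |σ₂| * (R ^ (1 + θ₁ - θ₂) * B) := by
          refine (mul_le_mul_of_nonneg_left hgR (Real.rpow_nonneg hR.le _)).trans_eq ?_
          rw [show θ₁ - 1 - θ₀ = θ₁ + (-1 - θ₀) by ring, Real.rpow_add hR θ₁ (-1 - θ₀),
            show 1 + θ₁ - θ₂ = θ₁ + (1 - θ₂) by ring, Real.rpow_add hR θ₁ (1 - θ₂)]
          ring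
        rw [e1, mul_assoc D]
        refine mul_le_mul_of_nonneg_left ?_ hD
        have n1 : 0 ≤ R ^ (θ₁ - 1 - θ₀) * A := by positivity
        have n2 : 0 ≤ R ^ (1 + θ₁ - θ₂) * B := by positivity
        have n3 : (0 : ℝ) ≤ 2 ^ |σ₀| := by positivity
        have n4 : (0 : ℝ) ≤ 2 ^ |σ₂| := by positivity
        nlinarith [mul_nonneg n3 n2, mul_nonneg n4 n1, mul_nonneg hC n1]

/-- Weighted estimate for `f'` away from the origin on the set where it is controlled by `f`. -/
theorem exists_eLpNorm_dominated_le {p₁ : ℝ≥0∞} {σ₁ θ₀ K : ℝ} (hp₁ : 1 ≤ p₁) (hp₁top : p₁ ≠ ⊤)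
    (hK : 0 ≤ K) (h01 : σ₁ + (1 / p₁).toReal - 1 - θ₀ < 0) :
    ∃ C : ℝ, 0 ≤ C ∧ ∀ g : ℝ → ℝ, ∀ A R : ℝ, 0 ≤ A → 0 < R →
      eLpNorm (fun x => x ^ σ₁ * g x) p₁
        (volume.restrict {x | R < x ∧ |g x| ≤ K * x ^ (-1 - θ₀) * A}) ≤
        ENNReal.ofReal (C * (R ^ (σ₁ + (1 / p₁).toReal - 1 - θ₀) * A)) := by
  obtain ⟨D, hD, hDR⟩ := exists_eLpNorm_rpow_Ioi_le (s := σ₁ - 1 - θ₀) hp₁ hp₁top (by linarith)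
  refine ⟨D * K, by positivity, fun g A R hA hR => ?_⟩
  have hP : 0 < p₁.toReal := ENNReal.toReal_pos (by positivity) hp₁top
  set S := {x | R < x ∧ |g x| ≤ K * x ^ (-1 - θ₀) * A}
  calc eLpNorm (fun x => x ^ σ₁ * g x) p₁ (volume.restrict S)
      ≤ eLpNorm ((K * A) • fun x : ℝ => x ^ (σ₁ - 1 - θ₀)) p₁ (volume.restrict S) := by
        simp only [eLpNorm_eq_lintegral_rpow_enorm_toReal (show p₁ ≠ 0 by positivity) hp₁top]
        refine ENNReal.rpow_le_rpow (setLIntegral_mono ?_ fun x hx => ?_) (by positivity)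
        · simp only [Pi.smul_apply]
          fun_prop
        · have hx0 : 0 < x := hR.trans hx.1
          have hxσ := Real.rpow_nonneg hx0.le σ₁
          refine ENNReal.rpow_le_rpow (enorm_le_iff_norm_le.2 ?_) hP.le
          have : 0 ≤ x ^ (σ₁ - 1 - θ₀) := Real.rpow_nonneg hx0.le _
          rw [norm_mul, Real.norm_of_nonneg hxσ, Pi.smul_apply, smul_eq_mul,
            Real.norm_of_nonneg (mul_nonneg (mul_nonneg hK hA) this), Real.norm_eq_abs]
          refine (mul_le_mul_of_nonneg_left hx.2 hxσ).trans_eq ?_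
          rw [show σ₁ - 1 - θ₀ = σ₁ + (-1 - θ₀) by ring, Real.rpow_add hx0]
          ring
    _ ≤ eLpNorm ((K * A) • fun x : ℝ => x ^ (σ₁ - 1 - θ₀)) p₁ (volume.restrict (Ioi R)) :=
        eLpNorm_mono_measure _ (Measure.restrict_mono_set _ fun x hx => hx.1)
    _ ≤ ENNReal.ofReal (K * A) * ENNReal.ofReal (D * R ^ (σ₁ - 1 - θ₀ + (1 / p₁).toReal)) := by
        rw [eLpNorm_const_smul, Real.enorm_of_nonneg (by positivity)]
        gcongr
        exact hDR R hR
    _ = _ := by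
        rw [← ENNReal.ofReal_mul (by positivity)]
        congr 1
        rw [show σ₁ - 1 - θ₀ + (1 / p₁).toReal = σ₁ + (1 / p₁).toReal - 1 - θ₀ by ring]
        ring

/-- The interpolation inequality on an interval where `f` and `f''` balance. -/
theorem exists_lintegral_balanced_le {p₀ p₂ p₁ : ℝ≥0∞} {σ₀ σ₁ σ₂ : ℝ}
    (hp₀ : 1 ≤ p₀) (hp₂ : 1 ≤ p₂) (hp₁ : 1 ≤ p₁) (hp₁top : p₁ ≠ ⊤)
    (hrel : 1 / p₂ + 1 / p₀ = 2 / p₁) (hσrel : σ₀ + σ₂ = 2 * σ₁) :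
    ∃ C : ℝ, 0 ≤ C ∧ ∀ f g h : ℝ → ℝ, (∀ x, 0 < x → HasDerivAt f (g x) x) →
      (∀ x, 0 < x → HasDerivAt g (h x) x) → ContinuousOn h (Ioi 0) →
      wLp σ₀ p₀ f < ⊤ → wLp σ₂ p₂ h < ⊤ → ∀ x r : ℝ, 0 < r → r ≤ x / 2 →
      (∫ y in (x - r)..(x + r), |f y|) = r ^ 2 * (∫ y in (x - r)..(x + r), |h y|) →
      ∫⁻ y in Icc (x - r) (x + r), ‖y ^ σ₁ * g y‖ₑ ^ p₁.toReal ≤ ENNReal.ofReal C *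
        (eLpNorm (fun y => y ^ σ₀ * f y) p₀ (volume.restrict (Icc (x - r) (x + r))) *
          eLpNorm (fun y => y ^ σ₂ * h y) p₂ (volume.restrict (Icc (x - r) (x + r)))) ^
            (p₁.toReal / 2) := by
  have hP : 1 ≤ p₁.toReal := by simpa using (ENNReal.toReal_le_toReal (by simp) hp₁top).2 hp₁
  have hP0 : 0 < p₁.toReal := by linarith
  have ha : (1 / p₂).toReal + (1 / p₀).toReal = 2 / p₁.toReal := by
    rw [← ENNReal.toReal_add (by simp; positivity) (by simp; positivity), hrel]
    simp
  set a₀ := (1 / p₀).toReal with ha₀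
  set a₂ := (1 / p₂).toReal with ha₂
  set K : ℝ := 144 * 2 ^ |σ₀| * 2 ^ |σ₂| * (2 ^ |σ₁|) ^ 2 with hK
  have hK0 : 0 ≤ K := by positivity
  refine ⟨2 * K ^ (p₁.toReal / 2), by positivity, fun f g h hf hg hh hA hB x r hr hrx hbal => ?_⟩
  have hx : 0 < x := by linarith
  have hsub : Icc (x - r) (x + r) ⊆ Ioi 0 := fun y hy => by
    have := hy.1
    simp only [mem_Ioi]
    linarith
  have hfc : ContinuousOn f (Ioi 0) := fun x hx => (hf x hx).continuousAt.continuousWithinAt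
  have hAfin : eLpNorm (fun y => y ^ σ₀ * f y) p₀ (volume.restrict (Icc (x - r) (x + r))) ≠ ⊤ :=
    ((eLpNorm_mono_measure _ (Measure.restrict_mono_set _ hsub)).trans_lt hA).ne
  have hBfin : eLpNorm (fun y => y ^ σ₂ * h y) p₂ (volume.restrict (Icc (x - r) (x + r))) ≠ ⊤ :=
    ((eLpNorm_mono_measure _ (Measure.restrict_mono_set _ hsub)).trans_lt hB).ne
  have hF := integral_abs_le_weighted_eLpNorm hp₀ hr hrx (hfc.mono hsub) hAfin
  have hH := integral_abs_le_weighted_eLpNorm hp₂ hr hrx (hh.mono hsub) hBfin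
  rw [← ENNReal.ofReal_toReal hAfin, ← ENNReal.ofReal_toReal hBfin]
  set α := (eLpNorm (fun y => y ^ σ₀ * f y) p₀ (volume.restrict (Icc (x - r) (x + r)))).toReal
  set β := (eLpNorm (fun y => y ^ σ₂ * h y) p₂ (volume.restrict (Icc (x - r) (x + r)))).toReal
  have hα : 0 ≤ α := ENNReal.toReal_nonneg
  have hβ : 0 ≤ β := ENNReal.toReal_nonneg
  set F := ∫ y in (x - r)..(x + r), |f y|
  set H := ∫ y in (x - r)..(x + r), |h y|
  have hF0 : 0 ≤ F := intervalIntegral.integral_nonneg (by linarith) fun _ _ => abs_nonneg _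
  have hH0 : 0 ≤ H := intervalIntegral.integral_nonneg (by linarith) fun _ _ => abs_nonneg _
  have hFH : F * H ≤ 4 * 2 ^ |σ₀| * 2 ^ |σ₂| * (r ^ 2 * r ^ (-(2 / p₁.toReal))) *
      ((x ^ σ₁) ^ 2)⁻¹ * (α * β) := by
    have hr2 : r ^ 2 * r ^ (-(2 / p₁.toReal)) = r ^ (1 - a₀) * r ^ (1 - a₂) := by
      rw [← Real.rpow_two, ← Real.rpow_add hr, ← Real.rpow_add hr, ← ha]
      congr 1
      ring
    have hx2 : ((x ^ σ₁) ^ 2)⁻¹ = x ^ (-σ₀) * x ^ (-σ₂) := by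
      rw [← Real.rpow_two, ← Real.rpow_mul hx.le, ← Real.rpow_neg hx.le, ← Real.rpow_add hx]
      congr 1
      linarith
    rw [hr2, hx2]
    exact (mul_le_mul hF hH hH0 (hF0.trans hF)).trans_eq (by ring)
  have hpt : ∀ y ∈ Icc (x - r) (x + r),
      (y ^ σ₁ * |g y|) ^ 2 ≤ K * r ^ (-(2 / p₁.toReal)) * (α * β) := by
    intro y hy
    have hy0 : 0 < y := hsub hy
    have h1 := abs_deriv_le_integral (show x - r < x + r by linarith)
      (fun y hy => hf y (hsub hy)) (fun y hy => hg y (hsub hy)) (hh.mono hsub) hy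
    have h2 : |g y| ≤ 6 * H := by
      refine h1.trans ?_
      have : 18 / (x + r - (x - r)) ^ 2 * F = 9 / 2 * H := by
        rw [hbal, show x + r - (x - r) = 2 * r by ring]
        field_simp
        ring
      linarith
    have h3 := rpow_le_two_rpow_abs_mul_rpow (y := y) σ₁ hx (by linarith [hy.1])
      (by linarith [hy.2])
    have hxσ : 0 < x ^ σ₁ := Real.rpow_pos_of_pos hx _
    have h4 : y ^ σ₁ * |g y| ≤ 2 ^ |σ₁| * x ^ σ₁ * (6 * H) :=
      mul_le_mul h3 h2 (abs_nonneg _) (by positivity)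
    calc (y ^ σ₁ * |g y|) ^ 2 ≤ (2 ^ |σ₁| * x ^ σ₁ * (6 * H)) ^ 2 :=
          pow_le_pow_left₀ (mul_nonneg (Real.rpow_nonneg hy0.le _) (abs_nonneg _)) h4 2
      _ = 36 * (2 ^ |σ₁|) ^ 2 * (x ^ σ₁) ^ 2 / r ^ 2 * (F * H) := by
          rw [hbal]
          field_simp
          ring
      _ ≤ 36 * (2 ^ |σ₁|) ^ 2 * (x ^ σ₁) ^ 2 / r ^ 2 * _ :=
          mul_le_mul_of_nonneg_left hFH (by positivity)
      _ = _ := by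
          rw [hK]
          field_simp
          ring
  have hpow : ∀ y ∈ Icc (x - r) (x + r), ‖y ^ σ₁ * g y‖ₑ ^ p₁.toReal ≤
      ENNReal.ofReal (K ^ (p₁.toReal / 2) * r⁻¹ * (α * β) ^ (p₁.toReal / 2)) := by
    intro y hy
    have hy0 : 0 < y := hsub hy
    have hyσ := Real.rpow_nonneg hy0.le σ₁
    have hn : 0 ≤ y ^ σ₁ * |g y| := mul_nonneg hyσ (abs_nonneg _)
    rw [← ofReal_norm, norm_mul, Real.norm_of_nonneg hyσ, Real.norm_eq_abs,
      ENNReal.ofReal_rpow_of_nonneg hn hP0.le]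
    refine ENNReal.ofReal_le_ofReal ?_
    calc (y ^ σ₁ * |g y|) ^ p₁.toReal = ((y ^ σ₁ * |g y|) ^ 2) ^ (p₁.toReal / 2) := by
          rw [← Real.rpow_two, ← Real.rpow_mul hn, mul_div_cancel₀ _ (two_ne_zero)]
      _ ≤ (K * r ^ (-(2 / p₁.toReal)) * (α * β)) ^ (p₁.toReal / 2) :=
          Real.rpow_le_rpow (by positivity) (hpt y hy) (by positivity)
      _ = _ := by
          rw [Real.mul_rpow (by positivity) (by positivity),
            Real.mul_rpow (by positivity) (by positivity), ← Real.rpow_mul hr.le,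
            show -(2 / p₁.toReal) * (p₁.toReal / 2) = -1 by field_simp, Real.rpow_neg_one]
  calc _ ≤ ∫⁻ _ in Icc (x - r) (x + r),
        ENNReal.ofReal (K ^ (p₁.toReal / 2) * r⁻¹ * (α * β) ^ (p₁.toReal / 2)) :=
        setLIntegral_mono' measurableSet_Icc hpow
    _ = _ := by
        rw [setLIntegral_const, Real.volume_Icc, ← ENNReal.ofReal_mul hα,
          ENNReal.ofReal_rpow_of_nonneg (by positivity) (by positivity),
          ← ENNReal.ofReal_mul (by positivity), ← ENNReal.ofReal_mul (by positivity)]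
        congr 1
        field_simp
        ring

/-- The interpolation inequality on the set of centres of balanced intervals. -/
theorem exists_eLpNorm_balanced_le {p₀ p₂ p₁ : ℝ≥0∞} {σ₀ σ₁ σ₂ : ℝ}
    (hp₀ : 1 ≤ p₀) (hp₂ : 1 ≤ p₂) (hp₁ : 1 ≤ p₁) (hp₁top : p₁ ≠ ⊤)
    (hrel : 1 / p₂ + 1 / p₀ = 2 / p₁) (hσrel : σ₀ + σ₂ = 2 * σ₁) :
    ∃ C : ℝ, 0 ≤ C ∧ ∀ f g h : ℝ → ℝ, (∀ x, 0 < x → HasDerivAt f (g x) x) →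
      (∀ x, 0 < x → HasDerivAt g (h x) x) → ContinuousOn h (Ioi 0) →
      wLp σ₀ p₀ f < ⊤ → wLp σ₂ p₂ h < ⊤ →
      eLpNorm (fun x => x ^ σ₁ * g x) p₁ (volume.restrict {x | ∃ r, 0 < r ∧ r ≤ x / 2 ∧
        (∫ y in (x - r)..(x + r), |f y|) = r ^ 2 * (∫ y in (x - r)..(x + r), |h y|)}) ≤
      ENNReal.ofReal C * (wLp σ₀ p₀ f * wLp σ₂ p₂ h) ^ (1 / 2 : ℝ) := by
  obtain ⟨C, hC, hCf⟩ := exists_lintegral_balanced_le hp₀ hp₂ hp₁ hp₁top hrel hσrel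
  obtain ⟨N, τ, hτ, hN⟩ := HasBesicovitchCovering.no_satelliteConfig (α := ℝ)
  have hP0 : 0 < p₁.toReal := ENNReal.toReal_pos (by positivity) hp₁top
  refine ⟨(N * C) ^ (1 / p₁.toReal), by positivity, fun f g h hf hg hh hA hB => ?_⟩
  set S := {x | ∃ r, 0 < r ∧ r ≤ x / 2 ∧
    (∫ y in (x - r)..(x + r), |f y|) = r ^ 2 * (∫ y in (x - r)..(x + r), |h y|)} with hS
  have hbdd : ∀ n : ℕ, ∫⁻ x in S ∩ Iio (n : ℝ), ‖x ^ σ₁ * g x‖ₑ ^ p₁.toReal ≤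
      N * (ENNReal.ofReal C * (wLp σ₀ p₀ f * wLp σ₂ p₂ h) ^ (p₁.toReal / 2)) := by
    intro n
    have hr : ∀ x : ↥(S ∩ Iio (n : ℝ)), ∃ r, 0 < r ∧ r ≤ (x : ℝ) / 2 ∧
      (∫ y in (x - r)..(x + r), |f y|) = r ^ 2 * (∫ y in (x - r)..(x + r), |h y|) :=
      fun x => x.2.1
    choose r hr0 hrx hbal using hr
    have hrn : ∀ x, r x ≤ n := fun x => by
      have h1 := hrx x
      have h2 : (x : ℝ) < n := x.2.2
      linarith [hr0 x]
    obtain ⟨s, hs, hcov⟩ := Besicovitch.exist_disjoint_covering_families hτ hN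
      { c := fun x : ↥(S ∩ Iio (n : ℝ)) => (x : ℝ), r := r, rpos := hr0, r_bound := n,
        r_le := hrn }
    simp only [Subtype.range_coe, Real.closedBall_eq_Icc] at hs hcov
    have hcount : ∀ i, Countable (s i) := fun i => by
      refine ((hs i).countable_of_nonempty_interior fun x _ => ?_).to_subtype
      rw [interior_Icc]
      exact nonempty_Ioo.2 (by linarith [hr0 x])
    calc ∫⁻ x in S ∩ Iio (n : ℝ), ‖x ^ σ₁ * g x‖ₑ ^ p₁.toReal
        ≤ ∫⁻ x in ⋃ i, ⋃ j : s i, Icc ((j : ℝ) - r j) (j + r j), ‖x ^ σ₁ * g x‖ₑ ^ p₁.toReal := by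
          refine lintegral_mono_set (hcov.trans ?_)
          refine iUnion_mono fun i => ?_
          rw [biUnion_eq_iUnion]
          refine iUnion_mono fun j => ?_
          rw [← Real.closedBall_eq_Icc]
          exact Metric.ball_subset_closedBall
      _ ≤ ∑' i, ∑' j : s i, ∫⁻ x in Icc ((j : ℝ) - r j) (j + r j),
            ‖x ^ σ₁ * g x‖ₑ ^ p₁.toReal :=
          (lintegral_iUnion_le _ _).trans (ENNReal.tsum_le_tsum fun i => lintegral_iUnion_le _ _)
      _ ≤ ∑' _ : Fin N, ENNReal.ofReal C * (wLp σ₀ p₀ f * wLp σ₂ p₂ h) ^ (p₁.toReal / 2) := by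
          refine ENNReal.tsum_le_tsum fun i => ?_
          refine (ENNReal.tsum_le_tsum fun j : s i =>
            hCf f g h hf hg hh hA hB _ (r j) (hr0 _) (hrx _) (hbal _)).trans ?_
          rw [ENNReal.tsum_mul_left]
          gcongr
          rw [ENNReal.tsum_eq_iSup_sum]
          refine iSup_le fun t => ?_
          have hsub : ∀ j : ↥(S ∩ Iio (n : ℝ)), Icc ((j : ℝ) - r j) (j + r j) ⊆ Ioi 0 :=
              fun j y hy => by
            have h1 := hy.1
            have h2 := hr0 j
            have h3 := hrx j
            simp only [mem_Ioi]
            linarith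
          have key := sum_eLpNorm_mul_eLpNorm_rpow_le (μ := volume.restrict (Ioi 0)) hp₀ hp₂ hp₁
            hp₁top hrel (fun y => y ^ σ₀ * f y) (fun y => y ^ σ₂ * h y) t
            (E := fun j : s i => Icc ((j : ℝ) - r j) (j + r j)) (fun _ _ => measurableSet_Icc)
            (fun j _ k _ hjk => hs i j.2 k.2 (fun h => hjk (Subtype.ext h)))
          simp only [Measure.restrict_restrict measurableSet_Icc,
            inter_eq_self_of_subset_left (hsub _)] at key
          exact key
      _ = _ := by simp
  have hunion : S = ⋃ n : ℕ, S ∩ Iio (n : ℝ) := by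
    rw [← inter_iUnion]
    refine (inter_eq_self_of_subset_left fun x _ => ?_).symm
    obtain ⟨n, hn⟩ := exists_nat_gt x
    exact mem_iUnion.2 ⟨n, hn⟩
  have htot : ∫⁻ x in S, ‖x ^ σ₁ * g x‖ₑ ^ p₁.toReal ≤
      N * (ENNReal.ofReal C * (wLp σ₀ p₀ f * wLp σ₂ p₂ h) ^ (p₁.toReal / 2)) := by
    rw [hunion, setLIntegral_iUnion_of_directed]
    · exact iSup_le hbdd
    · refine Monotone.directed_le fun m n hmn => inter_subset_inter_right _ (Iio_subset_Iio ?_)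
      exact_mod_cast hmn
  rw [eLpNorm_eq_lintegral_rpow_enorm_toReal (by positivity) hp₁top]
  calc _ ≤ (N * (ENNReal.ofReal C * (wLp σ₀ p₀ f * wLp σ₂ p₂ h) ^ (p₁.toReal / 2))) ^
        (1 / p₁.toReal) := by gcongr
    _ = _ := by
      rw [← mul_assoc, ENNReal.mul_rpow_of_nonneg _ _ (by positivity), ← ENNReal.rpow_mul,
        ← ENNReal.ofReal_natCast, ← ENNReal.ofReal_mul (by positivity),
        ENNReal.ofReal_rpow_of_nonneg (by positivity) (by positivity)]
      congr 2
      field_simp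

theorem exists_rpow_neg_mul_add_rpow_mul_le {δ A B ε : ℝ} (hδ : 0 < δ) (hA : 0 ≤ A) (hB : 0 ≤ B)
    (hε : 0 < ε) : ∃ R : ℝ, 0 < R ∧ R ^ (-δ) * A + R ^ δ * B ≤ 2 * √(A * B) + ε := by
  suffices h : ∃ ρ : ℝ, 0 < ρ ∧ ρ⁻¹ * A + ρ * B ≤ 2 * √(A * B) + ε by
    obtain ⟨ρ, hρ, h⟩ := h
    refine ⟨ρ ^ δ⁻¹, by positivity, ?_⟩
    rwa [Real.rpow_neg (by positivity), Real.rpow_inv_rpow hρ.le hδ.ne']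
  rcases hA.eq_or_lt with rfl | hA'
  · refine ⟨ε / (B + 1), by positivity, ?_⟩
    have : ε / (B + 1) * B ≤ ε := by
      rw [div_mul_eq_mul_div, div_le_iff₀ (by positivity)]
      nlinarith
    simpa using this
  rcases hB.eq_or_lt with rfl | hB'
  · refine ⟨A / ε, by positivity, ?_⟩
    have : (A / ε)⁻¹ * A = ε := by field_simp
    rw [this]
    simp
  · refine ⟨√A / √B, by positivity, ?_⟩
    have e1 : (√A / √B)⁻¹ * A = √A * √B := by
      nth_rewrite 2 [← Real.mul_self_sqrt hA]
      field_simp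
    have e2 : √A / √B * B = √A * √B := by
      nth_rewrite 2 [← Real.mul_self_sqrt hB]
      field_simp
    rw [e1, e2, Real.sqrt_mul hA]
    linarith

/-- The interpolation inequality with an unbalanced remainder at an arbitrary scale `R`. -/
theorem exists_wLp_deriv_le {p₀ p₂ p₁ : ℝ≥0∞} {σ₀ σ₁ σ₂ δ : ℝ}
    (hp₀ : 1 ≤ p₀) (hp₂ : 1 ≤ p₂) (hp₁ : 1 ≤ p₁) (hp₁top : p₁ ≠ ⊤)
    (hrel : 1 / p₂ + 1 / p₀ = 2 / p₁) (hσrel : σ₀ + σ₂ = 2 * σ₁)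
    (hδ : δ = 1 + (σ₁ + (1 / p₁).toReal) - (σ₂ + (1 / p₂).toReal)) (hδ0 : 0 < δ)
    (hσ₁ : 0 < σ₁ + (1 / p₁).toReal) :
    ∃ C : ℝ, 0 ≤ C ∧ ∀ f g h : ℝ → ℝ, (∀ x, 0 < x → HasDerivAt f (g x) x) →
      (∀ x, 0 < x → HasDerivAt g (h x) x) → ContinuousOn h (Ioi 0) →
      wLp σ₀ p₀ f < ⊤ → wLp σ₂ p₂ h < ⊤ → ∀ R : ℝ, 0 < R →
      wLp σ₁ p₁ g ≤ ENNReal.ofReal (C * (R ^ (-δ) * (wLp σ₀ p₀ f).toReal +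
        R ^ δ * (wLp σ₂ p₂ h).toReal +
        √((wLp σ₀ p₀ f).toReal * (wLp σ₂ p₂ h).toReal))) := by
  have ha : (1 / p₂).toReal + (1 / p₀).toReal = 2 * (1 / p₁).toReal := by
    rw [← ENNReal.toReal_add (by simp; positivity) (by simp; positivity), hrel]
    simp [div_eq_mul_inv]
  have hδ' : σ₁ + (1 / p₁).toReal - 1 - (σ₀ + (1 / p₀).toReal) = -δ := by linarith
  obtain ⟨C₁, hC₁, hs⟩ := exists_eLpNorm_Ioc_le (σ₀ := σ₀) hp₀ hp₂ hp₁ hσ₁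
    (show (σ₂ + (1 / p₂).toReal) - (σ₁ + (1 / p₁).toReal) < 1 by linarith)
  obtain ⟨C₂, hC₂, hd⟩ := exists_eLpNorm_dominated_le (K := 44 * 2 ^ |σ₀|) hp₁ hp₁top
    (by positivity) (hδ'.trans_lt (neg_lt_zero.2 hδ0))
  obtain ⟨C₃, hC₃, hb⟩ := exists_eLpNorm_balanced_le hp₀ hp₂ hp₁ hp₁top hrel hσrel
  refine ⟨C₁ + C₂ + C₃, by positivity, fun f g h hf hg hh hA hB R hR => ?_⟩
  have hs := hs f g h hf hg hh hA hB R hR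
  have hd := hd g (wLp σ₀ p₀ f).toReal R ENNReal.toReal_nonneg hR
  have hb := hb f g h hf hg hh hA hB
  rw [hδ', ← hδ] at hs
  rw [hδ'] at hd
  rw [← ENNReal.ofReal_toReal hA.ne, ← ENNReal.ofReal_toReal hB.ne,
    ← ENNReal.ofReal_mul ENNReal.toReal_nonneg,
    ENNReal.ofReal_rpow_of_nonneg (by positivity) (by positivity), ← Real.sqrt_eq_rpow,
    ← ENNReal.ofReal_mul hC₃] at hb
  set A := (wLp σ₀ p₀ f).toReal
  set B := (wLp σ₂ p₂ h).toReal
  have hA0 : 0 ≤ A := ENNReal.toReal_nonneg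
  have hB0 : 0 ≤ B := ENNReal.toReal_nonneg
  set Sb := {x : ℝ | ∃ r, 0 < r ∧ r ≤ x / 2 ∧
    (∫ y in (x - r)..(x + r), |f y|) = r ^ 2 * (∫ y in (x - r)..(x + r), |h y|)}
  set Sd := {x : ℝ | R < x ∧ |g x| ≤ 44 * 2 ^ |σ₀| * x ^ (-1 - (σ₀ + (1 / p₀).toReal)) * A}
  have hcover : Ioi 0 ⊆ Ioc 0 R ∪ (Sd ∪ Sb) := by
    intro x hx
    have hx0 : 0 < x := hx
    rcases le_or_gt x R with hxR | hxR
    · exact Or.inl ⟨hx0, hxR⟩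
    right
    rcases eq_or_ne (g x) 0 with hgx | hgx
    · refine Or.inl ⟨hxR, ?_⟩
      rw [hgx, abs_zero]
      positivity
    rcases le_or_gt ((x / 2) ^ 2 * (∫ y in (x - x / 2)..(x + x / 2), |h y|))
      (∫ y in (x - x / 2)..(x + x / 2), |f y|) with hdom | hdom
    · exact Or.inl ⟨hxR, abs_deriv_le_wLp_of_dominated hp₀ hf hg hh hA hx0 hdom⟩
    · have hpos : ∀ y ∈ Icc (x - x / 2) (x + x / 2), 0 < y := fun y hy => by linarith [hy.1]
      exact Or.inr (exists_balanced_radius (half_pos hx0) (fun y hy => hf y (hpos y hy))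
        (fun y hy => hg y (hpos y hy)) (hh.mono hpos) hgx hdom)
  have hRA : 0 ≤ R ^ (-δ) * A := by positivity
  have hRB : 0 ≤ R ^ δ * B := by positivity
  have hsq := Real.sqrt_nonneg (A * B)
  calc wLp σ₁ p₁ g ≤ eLpNorm (fun x => x ^ σ₁ * g x) p₁
        (volume.restrict (Ioc 0 R ∪ (Sd ∪ Sb))) :=
        eLpNorm_mono_measure _ (Measure.restrict_mono_set _ hcover)
    _ ≤ _ := (eLpNorm_restrict_union_le hp₁ hp₁top _ _ _).trans
        (add_le_add hs ((eLpNorm_restrict_union_le hp₁ hp₁top _ _ _).trans (add_le_add hd hb)))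
    _ ≤ _ := by
        rw [← ENNReal.ofReal_add (by positivity) (by positivity),
          ← ENNReal.ofReal_add (by positivity) (by positivity)]
        refine ENNReal.ofReal_le_ofReal ?_
        nlinarith [mul_nonneg hC₁ hsq, mul_nonneg hC₂ hRB, mul_nonneg hC₂ hsq,
          mul_nonneg hC₃ hRA, mul_nonneg hC₃ hRB]

/-- **One-dimensional weighted Gagliardo–Nirenberg interpolation** (Lemma 2.18):
if `1/p₂ + 1/p₀ = 2/p₁`, `σ₀ + σ₂ = 2σ₁`, `2 - (1/p₂ - 1/p₀) > σ₂ - σ₀` and `σ₁ > -1/p₁`,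
then `‖x^{σ₁} f'‖_{L^{p₁}} ≤ C ‖x^{σ₀} f‖_{L^{p₀}}^{1/2} ‖x^{σ₂} f''‖_{L^{p₂}}^{1/2}`
for all `f ∈ C²((0,∞))` with finite right-hand side. -/
theorem weighted_gagliardo_nirenberg_1d
    (p₀ p₂ p₁ : ℝ≥0∞) (σ₀ σ₁ σ₂ : ℝ)
    (hp₀ : 1 ≤ p₀) (hp₂ : 1 ≤ p₂) (hp₁ : 1 ≤ p₁) (hp₁top : p₁ ≠ ⊤)
    (hrel : 1 / p₂ + 1 / p₀ = 2 / p₁)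
    (hσrel : σ₀ + σ₂ = 2 * σ₁)
    (hmain : σ₂ - σ₀ < 2 - ((1 / p₂).toReal - (1 / p₀).toReal))
    (hσ₁ : -(1 / p₁).toReal < σ₁) :
    ∃ C : ℝ≥0∞, C ≠ ⊤ ∧ ∀ f : ℝ → ℝ, ContDiffOn ℝ 2 f (Set.Ioi 0) →
      wLp σ₀ p₀ f < ⊤ → wLp σ₂ p₂ (deriv (deriv f)) < ⊤ →
      wLp σ₁ p₁ (deriv f)
        ≤ C * wLp σ₀ p₀ f ^ (1/2 : ℝ) * wLp σ₂ p₂ (deriv (deriv f)) ^ (1/2 : ℝ) := by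
  have ha : (1 / p₂).toReal + (1 / p₀).toReal = 2 * (1 / p₁).toReal := by
    rw [← ENNReal.toReal_add (by simp; positivity) (by simp; positivity), hrel]
    simp [div_eq_mul_inv]
  obtain ⟨δ, hδ⟩ : ∃ δ, δ = 1 + (σ₁ + (1 / p₁).toReal) - (σ₂ + (1 / p₂).toReal) := ⟨_, rfl⟩
  have hδ0 : 0 < δ := by linarith
  obtain ⟨C, hC, hCf⟩ := exists_wLp_deriv_le hp₀ hp₂ hp₁ hp₁top hrel hσrel hδ hδ0 (by linarith)
  refine ⟨ENNReal.ofReal (3 * C), ENNReal.ofReal_ne_top, fun f hf hA hB => ?_⟩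
  have hg1 : ContDiffOn ℝ 1 (deriv f) (Ioi 0) :=
    ((contDiffOn_succ_iff_deriv_of_isOpen (n := 1) isOpen_Ioi).1 hf).2.2
  have hd1 : ∀ x, 0 < x → HasDerivAt f (deriv f x) x := fun x hx =>
    ((hf.differentiableOn (by norm_num)).differentiableAt (Ioi_mem_nhds hx)).hasDerivAt
  have hd2 : ∀ x, 0 < x → HasDerivAt (deriv f) (deriv (deriv f) x) x := fun x hx =>
    ((hg1.differentiableOn (by norm_num)).differentiableAt (Ioi_mem_nhds hx)).hasDerivAt
  have hcont : ContinuousOn (deriv (deriv f)) (Ioi 0) :=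
    hg1.continuousOn_deriv_of_isOpen isOpen_Ioi le_rfl
  have hR := hCf f _ _ hd1 hd2 hcont hA hB
  rw [mul_assoc, ← ENNReal.mul_rpow_of_nonneg _ _ (by positivity)]
  rw [← ENNReal.ofReal_toReal hA.ne, ← ENNReal.ofReal_toReal hB.ne,
    ← ENNReal.ofReal_mul ENNReal.toReal_nonneg,
    ENNReal.ofReal_rpow_of_nonneg (by positivity) (by positivity), ← Real.sqrt_eq_rpow,
    ← ENNReal.ofReal_mul (by positivity)]
  set A := (wLp σ₀ p₀ f).toReal
  set B := (wLp σ₂ p₂ (deriv (deriv f))).toReal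
  refine ENNReal.le_of_forall_pos_le_add fun ε hε _ => ?_
  obtain ⟨R, hR0, hRε⟩ := exists_rpow_neg_mul_add_rpow_mul_le (A := A) (B := B)
    (ε := ε / (C + 1)) hδ0 ENNReal.toReal_nonneg ENNReal.toReal_nonneg (by positivity)
  refine (hR R hR0).trans ?_
  rw [← ENNReal.ofReal_coe_nnreal, ← ENNReal.ofReal_add (by positivity) ε.coe_nonneg]
  refine ENNReal.ofReal_le_ofReal ?_
  have hCε : C * (ε / (C + 1)) ≤ ε := by
    rw [mul_div_assoc', div_le_iff₀ (by positivity)]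
    nlinarith [ε.coe_nonneg]
  calc _ ≤ C * (2 * √(A * B) + ε / (C + 1) + √(A * B)) := by gcongr
    _ = 3 * C * √(A * B) + C * (ε / (C + 1)) := by ring
    _ ≤ _ := by gcongr
end

section
/- One-dimensional weighted interpolation against the adapted Hölder norm (Lemma 2.22 with d = 1): Let p₁ ∈ [2,∞), p₂ = p₁/2, and σ₁, σ₂ ∈ ℝ with σ₂ − 1/2 = 2σ₁, 2 − 1/p₂ > σ₂ + 1/2, and σ₁ > −1/p₁. Then there is a constant C, depending only on the exponents, such that for every f ∈ C²((0,∞)) with ‖f‖_{C̃^{0,1/2}} < ∞ and ‖x^{σ₂} f″‖_{L^{p₂}(0,∞)} < ∞, ‖x^{σ₁} f′‖_{L^{p₁}(0,∞)} ≤ C ‖f‖_{C̃^{0,1/2}}^{1/2} ‖x^{σ₂} f″‖_{L^{p₂}(0,∞)}^{1/2}. -/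
open MeasureTheory Set
open scoped ENNReal

theorem hasDerivAt_abs_rpow_mul_self {p : ℝ} (hp : 2 ≤ p) (u : ℝ) :
    HasDerivAt (fun u : ℝ => |u| ^ (p - 2) * u) ((p - 1) * |u| ^ (p - 2)) u := by
  rcases hp.eq_or_lt with rfl | hp
  · norm_num
    exact hasDerivAt_id u
  rcases eq_or_ne u 0 with rfl | hu
  · rw [hasDerivAt_iff_tendsto_slope, abs_zero, Real.zero_rpow (by linarith), mul_zero]
    have hc : Continuous fun u : ℝ => |u| ^ (p - 2) :=
      continuous_abs.rpow_const fun _ => Or.inr (by linarith)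
    have ht := (hc.tendsto 0).mono_left (nhdsWithin_le_nhds (s := {0}ᶜ))
    rw [abs_zero, Real.zero_rpow (by linarith)] at ht
    refine ht.congr' ?_
    filter_upwards [self_mem_nhdsWithin] with v hv
    have hv : v ≠ 0 := hv
    simp [slope_def_field, hv]
  · have h := ((hasDerivAt_abs hu).rpow_const (p := p - 2)
      (Or.inl (abs_ne_zero.2 hu))).mul (hasDerivAt_id u)
    refine h.congr_deriv ?_
    have hs : (SignType.sign u : ℝ) * u = |u| := by rw [mul_comm]; exact self_mul_sign u
    have hr : |u| ^ (p - 2 - 1) * |u| = |u| ^ (p - 2) := by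
      rw [← Real.rpow_add_one (abs_ne_zero.2 hu)]; congr 1; ring
    simp only [id]
    calc _ = (p - 2) * (|u| ^ (p - 2 - 1) * ((SignType.sign u : ℝ) * u)) + |u| ^ (p - 2) := by ring
      _ = _ := by rw [hs, hr]; ring

theorem rpow_sub_two_mul_le {p u v k : ℝ} (hp : 2 ≤ p) (hu : 0 ≤ u) (hv : 0 ≤ v) (hk : 0 < k) :
    u ^ (p - 2) * v ≤ u ^ p / k + k ^ ((p - 2) / 2) * v ^ (p / 2) := by
  rcases le_total (u ^ 2) (k * v) with h | h
  · have h1 : u ^ (p - 2) ≤ (k * v) ^ ((p - 2) / 2) := by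
      calc u ^ (p - 2) = (u ^ 2) ^ ((p - 2) / 2) := by
            rw [← Real.rpow_natCast, ← Real.rpow_mul hu]; congr 1; push_cast; ring
        _ ≤ _ := Real.rpow_le_rpow (by positivity) h (by linarith)
    have h2 : v ^ ((p - 2) / 2) * v = v ^ (p / 2) := by
      rw [← Real.rpow_add_one' hv (by linarith)]; congr 1; ring
    calc u ^ (p - 2) * v ≤ (k * v) ^ ((p - 2) / 2) * v := by gcongr
      _ = k ^ ((p - 2) / 2) * v ^ (p / 2) := by rw [Real.mul_rpow hk.le hv, mul_assoc, h2]
      _ ≤ _ := le_add_of_nonneg_left (by positivity)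
  · have h2 : u ^ (p - 2) * u ^ 2 = u ^ p := by
      rw [← Real.rpow_natCast, ← Real.rpow_add' hu (by push_cast; linarith)]; congr 1
      push_cast; ring
    have h3 : v ≤ u ^ 2 / k := by rw [le_div_iff₀ hk]; linarith
    calc u ^ (p - 2) * v ≤ u ^ (p - 2) * (u ^ 2 / k) := by gcongr
      _ = u ^ p / k := by rw [← h2]; ring
      _ ≤ _ := le_add_of_nonneg_right (by positivity)

theorem rpow_sub_one_mul_le {p u v k : ℝ} (hp : 1 < p) (hu : 0 ≤ u) (hv : 0 ≤ v) (hk : 0 < k) :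
    u ^ (p - 1) * v ≤ u ^ p / k + k ^ (p - 1) * v ^ p := by
  rcases le_total u (k * v) with h | h
  · have h2 : v ^ (p - 1) * v = v ^ p := by
      rw [← Real.rpow_add_one' hv (by linarith)]; congr 1; ring
    calc u ^ (p - 1) * v ≤ (k * v) ^ (p - 1) * v := by
          gcongr
      _ = k ^ (p - 1) * v ^ p := by rw [Real.mul_rpow hk.le hv, mul_assoc, h2]
      _ ≤ _ := le_add_of_nonneg_left (by positivity)
  · have h2 : u ^ (p - 1) * u = u ^ p := by
      rw [← Real.rpow_add_one' hu (by linarith)]; congr 1; ring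
    have h3 : v ≤ u / k := by rw [le_div_iff₀ hk]; linarith
    calc u ^ (p - 1) * v ≤ u ^ (p - 1) * (u / k) := by gcongr
      _ = u ^ p / k := by rw [← h2]; ring
      _ ≤ _ := le_add_of_nonneg_right (by positivity)

theorem le_add_rpow_mul_rpow {q v t : ℝ} (hq : 1 ≤ q) (hv : 0 ≤ v) (ht : 0 < t) :
    v ≤ t + v ^ q * t ^ (1 - q) := by
  rcases le_total v t with h | h
  · exact h.trans (le_add_of_nonneg_right (by positivity))
  · have hv' : 0 < v := ht.trans_le h
    calc v = v ^ q * v ^ (1 - q) := by rw [← Real.rpow_add hv']; simp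
      _ ≤ v ^ q * t ^ (1 - q) := by
          gcongr ?_ * ?_; exact Real.rpow_le_rpow_of_nonpos ht h (by linarith)
      _ ≤ _ := le_add_of_nonneg_left ht.le

/-- Some point of `(N, 2N)` has a derivative obeying the bound expected from the Hölder norm. -/
theorem exists_abs_deriv_le {f g : ℝ → ℝ} (hf : ∀ x, 0 < x → HasDerivAt f (g x) x)
    (hF : ∀ x, 0 < x → ∀ y, 0 < y → |f x - f y| ≤ √x + √y + √|x - y|) {N : ℝ} (hN : 0 < N) :
    ∃ t ∈ Ioo N (2 * N), |g t| ≤ 6 * t ^ (-(1 / 2) : ℝ) := by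
  obtain ⟨t, ht, hgt⟩ := exists_hasDerivAt_eq_slope f g (by linarith : N < 2 * N)
    (fun x hx => (hf x (hN.trans_le hx.1)).continuousAt.continuousWithinAt)
    (fun x hx => hf x (hN.trans hx.1))
  have ht0 : 0 < t := hN.trans ht.1
  refine ⟨t, ht, ?_⟩
  have h1 := hF (2 * N) (by linarith) N hN
  rw [show 2 * N - N = N by ring] at h1 hgt
  rw [abs_of_pos hN, Real.sqrt_mul (by norm_num)] at h1
  have hs2 : √2 ^ 2 = 2 := Real.sq_sqrt (by norm_num)
  have hs20 := Real.sqrt_nonneg 2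
  have hsN : √N ^ 2 = N := Real.sq_sqrt hN.le
  have hsN0 := Real.sqrt_pos.2 hN
  have hst0 := Real.sqrt_pos.2 ht0
  have hst : √t ≤ √2 * √N := by rw [← Real.sqrt_mul (by norm_num)]; exact Real.sqrt_le_sqrt ht.2.le
  rw [hgt, abs_div, abs_of_pos hN, Real.rpow_neg ht0.le, ← Real.sqrt_eq_rpow, ← div_eq_mul_inv,
    div_le_div_iff₀ hN hst0]
  have h2 : |f (2 * N) - f N| * √t ≤ (√2 * √N + √N + √N) * (√2 * √N) := by gcongr
  have h3 : (√2 * √N + √N + √N) * (√2 * √N) = (2 + 2 * √2) * N := by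
    linear_combination (√2 ^ 2 + 2 * √2) * hsN + N * hs2
  have h4 : √2 ≤ 2 := by nlinarith
  nlinarith

theorem integral_rpow_le_of_one_le {s a b : ℝ} (hs : 0 < s) (ha : 1 ≤ a) (hab : a ≤ b) :
    ∫ x in a..b, x ^ (-s - 1) ≤ 1 / s := by
  have ha0 : 0 < a := by linarith
  rw [integral_rpow (Or.inr ⟨by linarith, by
    rw [uIcc_of_le hab]; exact fun h => absurd h.1 (not_le.2 ha0)⟩)]
  rw [show -s - 1 + 1 = -s by ring, ← neg_div_neg_eq, neg_neg]
  have h1 : a ^ (-s) ≤ 1 := Real.rpow_le_one_of_one_le_of_nonpos ha (by linarith)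
  have h2 : 0 ≤ b ^ (-s) := by have := ha0.trans_le hab; positivity
  gcongr
  linarith

theorem abs_rpow_mul_rpow {g x σ : ℝ} (hx : 0 < x) (p : ℝ) :
    |g| ^ p * x ^ (σ * p) = (|g| * x ^ σ) ^ p := by
  rw [Real.mul_rpow (abs_nonneg _) (by positivity), ← Real.rpow_mul hx.le]

theorem exists_integral_far_le {p σ : ℝ} (hp : 2 ≤ p) (hδ : σ * p < p / 2 - 1) :
    ∃ C : ℝ, ∀ f g h : ℝ → ℝ, (∀ x, 0 < x → HasDerivAt f (g x) x) →
      (∀ x, 0 < x → HasDerivAt g (h x) x) → ContinuousOn h (Ioi 0) →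
      (∀ x, 0 < x → ∀ y, 0 < y → |f x - f y| ≤ √x + √y + √|x - y|) →
      (∀ a b, 0 < a → a ≤ b →
        ∫ x in a..b, |h x| ^ (p / 2) * x ^ ((2 * σ + 1 / 2) * (p / 2)) ≤ 1) →
      ∀ a b, 1 ≤ a → a ≤ b → |g a| ≤ 6 * a ^ (-(1 / 2) : ℝ) → |g b| ≤ 6 * b ^ (-(1 / 2) : ℝ) →
        ∫ x in a..b, |g x| ^ p * x ^ (σ * p) ≤ C := by
  set k₁ : ℝ := 12 * p
  set k₂ : ℝ := 12 * (|σ * p| + 1)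
  have hk₁ : 0 < k₁ := by positivity
  have hk₂ : 0 < k₂ := by positivity
  set c₁ : ℝ := 3 * (p - 1) * k₁ ^ ((p - 2) / 2)
  set c₂ : ℝ := 3 * |σ * p| * k₂ ^ (p - 1)
  have hc₁ : 0 ≤ c₁ := mul_nonneg (by linarith) (by positivity)
  have hc₂ : 0 ≤ c₂ := by positivity
  set δ : ℝ := p / 2 - 1 - σ * p with hδdef
  have hδ0 : 0 < δ := by linarith
  refine ⟨2 * (2 * (3 * 6 ^ (p - 1)) + c₁ + c₂ * (1 / δ)), ?_⟩
  intro f g h hf hg hh hF hK a b ha hab hga hgb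
  have hfx : ∀ x, 1 ≤ x → |f x - f 1| ≤ 3 * √x := by
    intro x hx
    have h1 := hF x (by linarith) 1 one_pos
    have h2 : √1 ≤ √x := Real.sqrt_le_sqrt hx
    have h3 : √|x - 1| ≤ √x := Real.sqrt_le_sqrt (by rw [abs_of_nonneg] <;> linarith)
    linarith
  have hpos : ∀ x ∈ Icc a b, 0 < x := fun x hx => by linarith [hx.1]
  have hu := uIcc_of_le hab
  set Φ : ℝ → ℝ := fun x => (f x - f 1) * ((|g x| ^ (p - 2) * g x) * x ^ (σ * p))
  set Φ' : ℝ → ℝ := fun x => g x * ((|g x| ^ (p - 2) * g x) * x ^ (σ * p)) +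
    (f x - f 1) * (((p - 1) * |g x| ^ (p - 2) * h x) * x ^ (σ * p) +
      (|g x| ^ (p - 2) * g x) * (σ * p * x ^ (σ * p - 1)))
  have hΦ : ∀ x ∈ uIcc a b, HasDerivAt Φ (Φ' x) x := by
    intro x hx
    rw [hu] at hx
    have hx0 := hpos x hx
    exact ((hf x hx0).sub_const _).mul
      (((hasDerivAt_abs_rpow_mul_self hp (g x)).comp x (hg x hx0)).mul
        (Real.hasDerivAt_rpow_const (Or.inl hx0.ne')))
  have hfc : ContinuousOn f (Icc a b) := fun x hx =>
    (hf x (hpos x hx)).continuousAt.continuousWithinAt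
  have hgc : ContinuousOn g (Icc a b) := fun x hx =>
    (hg x (hpos x hx)).continuousAt.continuousWithinAt
  have hhc : ContinuousOn h (Icc a b) := hh.mono hpos
  have hxc : ∀ r : ℝ, ContinuousOn (fun x : ℝ => x ^ r) (Icc a b) := fun r =>
    continuousOn_id.rpow_const fun x hx => Or.inl (hpos x hx).ne'
  have hgr : ∀ r : ℝ, 0 ≤ r → ContinuousOn (fun x : ℝ => |g x| ^ r) (Icc a b) := fun r hr =>
    hgc.abs.rpow_const fun x hx => Or.inr hr
  have hhr : ContinuousOn (fun x : ℝ => |h x| ^ (p / 2)) (Icc a b) :=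
    hhc.abs.rpow_const fun x hx => Or.inr (by linarith)
  have hΦc : ContinuousOn Φ' (Icc a b) := by
    have h1 := hgr (p - 2) (by linarith)
    exact (hgc.mul ((h1.mul hgc).mul (hxc _))).add ((hfc.sub continuousOn_const).mul
      ((((continuousOn_const.mul h1).mul hhc).mul (hxc _)).add
        ((h1.mul hgc).mul (continuousOn_const.mul (hxc _)))))
  have hΦi : IntervalIntegrable Φ' volume a b := (hu ▸ hΦc).intervalIntegrable
  have hgi : IntervalIntegrable (fun x => |g x| ^ p * x ^ (σ * p)) volume a b :=
    ContinuousOn.intervalIntegrable (hu ▸ (hgr p (by linarith)).mul (hxc _))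
  have hhi : IntervalIntegrable (fun x => |h x| ^ (p / 2) * x ^ ((2 * σ + 1 / 2) * (p / 2)))
      volume a b := ContinuousOn.intervalIntegrable (hu ▸ hhr.mul (hxc _))
  have hxi : IntervalIntegrable (fun x : ℝ => x ^ (-δ - 1)) volume a b :=
    ContinuousOn.intervalIntegrable (hu ▸ hxc _)
  have hFTC := intervalIntegral.integral_eq_sub_of_hasDerivAt hΦ hΦi
  have hend : ∀ x, 1 ≤ x → |g x| ≤ 6 * x ^ (-(1 / 2) : ℝ) → |Φ x| ≤ 3 * 6 ^ (p - 1) := by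
    intro x hx hgx
    have hx0 : 0 < x := by linarith
    have h1 : |g x| ^ (p - 2) * |g x| = |g x| ^ (p - 1) := by
      rw [← Real.rpow_add_one' (abs_nonneg _) (by linarith)]; congr 1; ring
    have h2 : |g x| ^ (p - 1) ≤ 6 ^ (p - 1) * x ^ (-(1 / 2) * (p - 1)) := by
      rw [Real.rpow_mul hx0.le, ← Real.mul_rpow (by norm_num) (by positivity)]
      exact Real.rpow_le_rpow (abs_nonneg _) hgx (by linarith)
    have h3 : x ^ (1 / 2 : ℝ) * x ^ (-(1 / 2) * (p - 1)) * x ^ (σ * p) = x ^ (-δ) := by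
      rw [← Real.rpow_add hx0, ← Real.rpow_add hx0]; congr 1; rw [hδdef]; ring
    have h4 : x ^ (-δ) ≤ 1 := Real.rpow_le_one_of_one_le_of_nonpos hx (by linarith)
    have h5 := hfx x hx
    rw [Real.sqrt_eq_rpow] at h5
    calc |Φ x| = |f x - f 1| * (|g x| ^ (p - 1) * x ^ (σ * p)) := by
          simp only [Φ, abs_mul]
          rw [abs_of_nonneg (by positivity : 0 ≤ |g x| ^ (p - 2)),
            abs_of_nonneg (by positivity : 0 ≤ x ^ (σ * p)), h1]
      _ ≤ 3 * x ^ (1 / 2 : ℝ) * ((6 ^ (p - 1) * x ^ (-(1 / 2) * (p - 1))) * x ^ (σ * p)) := by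
          gcongr
      _ = 3 * 6 ^ (p - 1) * (x ^ (1 / 2 : ℝ) * x ^ (-(1 / 2) * (p - 1)) * x ^ (σ * p)) := by ring
      _ ≤ 3 * 6 ^ (p - 1) * 1 := by rw [h3]; gcongr
      _ = _ := mul_one _
  have hpt : ∀ x ∈ Icc a b, |g x| ^ p * x ^ (σ * p) * (1 / 2) ≤ Φ' x +
      c₁ * (|h x| ^ (p / 2) * x ^ ((2 * σ + 1 / 2) * (p / 2))) + c₂ * x ^ (-δ - 1) := by
    intro x hx
    have hx0 := hpos x hx
    have h5 := hfx x (ha.trans hx.1)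
    rw [Real.sqrt_eq_rpow] at h5
    have hY := rpow_sub_two_mul_le (u := |g x| * x ^ σ) (v := |h x| * x ^ (2 * σ + 1 / 2)) hp
      (by positivity) (by positivity) hk₁
    have hZ := rpow_sub_one_mul_le (p := p) (u := |g x| * x ^ σ) (v := x ^ (σ - 1 / 2))
      (by linarith) (by positivity) (by positivity) hk₂
    have hw : (x ^ (σ - 1 / 2)) ^ p = x ^ (-δ - 1) := by
      rw [← Real.rpow_mul hx0.le]; congr 1; rw [hδdef]; ring
    rw [hw, ← abs_rpow_mul_rpow hx0, ← abs_rpow_mul_rpow hx0] at hZ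
    rw [← abs_rpow_mul_rpow hx0, ← abs_rpow_mul_rpow hx0, ← abs_rpow_mul_rpow hx0] at hY
    have h1 : |g x| ^ (p - 2) * |g x| = |g x| ^ (p - 1) := by
      rw [← Real.rpow_add_one' (abs_nonneg _) (by linarith)]; congr 1; ring
    have h2 : |g x| ^ (p - 1) * |g x| = |g x| ^ p := by
      rw [← Real.rpow_add_one' (abs_nonneg _) (by linarith)]; congr 1; ring
    have t1 : g x * ((|g x| ^ (p - 2) * g x) * x ^ (σ * p)) = |g x| ^ p * x ^ (σ * p) := by
      rw [← h2, ← h1]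
      linear_combination (-|g x| ^ (p - 2) * x ^ (σ * p)) * abs_mul_abs_self (g x)
    have e2 : x ^ (1 / 2 : ℝ) * x ^ (σ * p) = x ^ (σ * (p - 2)) * x ^ (2 * σ + 1 / 2) := by
      rw [← Real.rpow_add hx0, ← Real.rpow_add hx0]; congr 1; ring
    have e3 : x ^ (1 / 2 : ℝ) * x ^ (σ * p - 1) = x ^ (σ * (p - 1)) * x ^ (σ - 1 / 2) := by
      rw [← Real.rpow_add hx0, ← Real.rpow_add hx0]; congr 1; ring
    have t2 : |(f x - f 1) * (((p - 1) * |g x| ^ (p - 2) * h x) * x ^ (σ * p))| ≤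
        3 * (p - 1) * (|g x| ^ (p - 2) * x ^ (σ * (p - 2)) * (|h x| * x ^ (2 * σ + 1 / 2))) := by
      rw [abs_mul, abs_mul, abs_mul, abs_mul, abs_of_nonneg (by linarith : 0 ≤ p - 1),
        abs_of_nonneg (by positivity : 0 ≤ |g x| ^ (p - 2)),
        abs_of_nonneg (by positivity : 0 ≤ x ^ (σ * p))]
      calc _ ≤ 3 * x ^ (1 / 2 : ℝ) * ((p - 1) * |g x| ^ (p - 2) * |h x| * x ^ (σ * p)) := by
            have : 0 ≤ p - 1 := by linarith
            gcongr
        _ = 3 * (p - 1) * |g x| ^ (p - 2) * |h x| * (x ^ (1 / 2 : ℝ) * x ^ (σ * p)) := by ring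
        _ = _ := by rw [e2]; ring
    have t3 : |(f x - f 1) * ((|g x| ^ (p - 2) * g x) * (σ * p * x ^ (σ * p - 1)))| ≤
        3 * |σ * p| * (|g x| ^ (p - 1) * x ^ (σ * (p - 1)) * x ^ (σ - 1 / 2)) := by
      rw [abs_mul, abs_mul, abs_mul, abs_mul (σ * p),
        abs_of_nonneg (by positivity : 0 ≤ |g x| ^ (p - 2)),
        abs_of_nonneg (by positivity : 0 ≤ x ^ (σ * p - 1)), h1]
      calc _ ≤ 3 * x ^ (1 / 2 : ℝ) * (|g x| ^ (p - 1) * (|σ * p| * x ^ (σ * p - 1))) := by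
            gcongr
        _ = 3 * |σ * p| * |g x| ^ (p - 1) * (x ^ (1 / 2 : ℝ) * x ^ (σ * p - 1)) := by ring
        _ = _ := by rw [e3]; ring
    have hU : 0 ≤ |g x| ^ p * x ^ (σ * p) := by positivity
    have q2 : 3 * (p - 1) * (|g x| ^ p * x ^ (σ * p) / k₁) ≤ |g x| ^ p * x ^ (σ * p) * (1 / 4) := by
      rw [mul_div_assoc', div_le_iff₀ hk₁]
      nlinarith
    have q3 : 3 * |σ * p| * (|g x| ^ p * x ^ (σ * p) / k₂) ≤
        |g x| ^ p * x ^ (σ * p) * (1 / 4) := by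
      rw [mul_div_assoc', div_le_iff₀ hk₂]
      nlinarith
    have r2 := mul_le_mul_of_nonneg_left hY (by linarith : 0 ≤ 3 * (p - 1))
    have r3 := mul_le_mul_of_nonneg_left hZ (by positivity : 0 ≤ 3 * |σ * p|)
    rw [mul_add] at r2 r3
    have s2 := (abs_le.1 t2).1
    have s3 := (abs_le.1 t3).1
    have hsum : Φ' x = |g x| ^ p * x ^ (σ * p) +
        ((f x - f 1) * (((p - 1) * |g x| ^ (p - 2) * h x) * x ^ (σ * p)) +
        (f x - f 1) * ((|g x| ^ (p - 2) * g x) * (σ * p * x ^ (σ * p - 1)))) := by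
      rw [← t1, ← mul_add]
    rw [hsum]
    simp only [c₁, c₂]
    linarith
  have hint := intervalIntegral.integral_mono_on hab (hgi.mul_const (1 / 2))
    ((hΦi.add (hhi.const_mul c₁)).add (hxi.const_mul c₂)) hpt
  rw [intervalIntegral.integral_add (hΦi.add (hhi.const_mul c₁)) (hxi.const_mul c₂),
    intervalIntegral.integral_add hΦi (hhi.const_mul c₁), intervalIntegral.integral_mul_const,
    intervalIntegral.integral_const_mul, intervalIntegral.integral_const_mul, hFTC] at hint
  have i1 := mul_le_mul_of_nonneg_left (hK a b (by linarith) hab) hc₁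
  have i2 := mul_le_mul_of_nonneg_left (integral_rpow_le_of_one_le hδ0 ha hab) hc₂
  have i3 := (abs_le.1 (hend a ha hga)).1
  have i4 := (abs_le.1 (hend b (ha.trans hab) hgb)).2
  linarith

theorem exists_integral_near_le {p σ : ℝ} (hp : 2 ≤ p) (hσ : -1 < σ * p)
    (hδ : σ * p < p / 2 - 1) :
    ∃ C : ℝ, ∀ g h : ℝ → ℝ,
      (∀ x, 0 < x → HasDerivAt g (h x) x) → ContinuousOn h (Ioi 0) →
      (∀ a b, 0 < a → a ≤ b →
        ∫ x in a..b, |h x| ^ (p / 2) * x ^ ((2 * σ + 1 / 2) * (p / 2)) ≤ 1) →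
      ∀ a t, 0 < a → a ≤ t → t ≤ 2 → |g t| ≤ 6 →
        ∫ x in a..t, |g x| ^ p * x ^ (σ * p) ≤ C := by
  have hp0 : 0 < p := by linarith
  obtain ⟨η, hη, hη2⟩ : ∃ η, max 0 (2 * σ - 1 / 2 + 2 / p) < η ∧ η < σ + 1 / p := by
    refine exists_between (max_lt ?_ ?_)
    · rw [← sub_neg_eq_add, sub_pos, ← neg_div, div_lt_iff₀ hp0]; exact hσ
    · have : σ < 1 / 2 - 1 / p := by
        rw [show (1 / 2 - 1 / p : ℝ) = (p / 2 - 1) / p by field_simp, lt_div_iff₀ hp0]; exact hδ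
      have h2 : 2 / p = 1 / p + 1 / p := by ring
      linarith
  obtain ⟨hη0, hη1⟩ := max_lt_iff.1 hη
  set γ : ℝ := 1 - 2 / p + η with hγ
  have hγs : 0 ≤ γ - (2 * σ + 1 / 2) := by rw [hγ]; linarith
  set M : ℝ := 2 ^ (γ - (2 * σ + 1 / 2))
  have hM : 0 < M := by positivity
  have hs : 0 < σ * p - η * p + 1 := by
    have := mul_lt_mul_of_pos_right hη2 hp0
    rw [add_mul, one_div_mul_cancel hp0.ne'] at this
    linarith
  set B : ℝ := 6 * 2 ^ η + M * (1 / η + 1)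
  have hB : 0 < B := by positivity
  refine ⟨B ^ p * (2 ^ (σ * p - η * p + 1) / (σ * p - η * p + 1)), ?_⟩
  intro g h hg hh hK a t ha hat ht hgt
  have hhr : ContinuousOn (fun x : ℝ => |h x| ^ (p / 2)) (Ioi 0) :=
    hh.abs.rpow_const fun x hx => Or.inr (by linarith)
  have hxc : ∀ r : ℝ, ContinuousOn (fun x : ℝ => x ^ r) (Ioi 0) := fun r =>
    continuousOn_id.rpow_const fun x hx => Or.inl (ne_of_gt hx)
  have hgc : ContinuousOn g (Ioi 0) := fun x hx => (hg x hx).continuousAt.continuousWithinAt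
  have hsub : ∀ x, 0 < x → x ≤ t → uIcc x t ⊆ Ioi 0 := fun x hx hxt => by
    rw [uIcc_of_le hxt]; exact fun y hy => hx.trans_le hy.1
  have hpt : ∀ y, 0 < y → y ≤ t → |h y| ≤ M * (y ^ (-η - 1) +
      |h y| ^ (p / 2) * y ^ ((2 * σ + 1 / 2) * (p / 2)) * y ^ (-η)) := by
    intro y hy hyt
    have h1 := le_add_rpow_mul_rpow (q := p / 2) (v := |h y| * y ^ (2 * σ + 1 / 2))
      (t := y ^ (-(2 / p))) (by linarith) (by positivity) (by positivity)
    rw [← abs_rpow_mul_rpow hy] at h1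
    have h2 : y ^ (γ - (2 * σ + 1 / 2)) ≤ M :=
      Real.rpow_le_rpow hy.le (hyt.trans ht) hγs
    have e1 : y ^ (2 * σ + 1 / 2) * (y ^ (γ - (2 * σ + 1 / 2)) * y ^ (-γ)) = 1 := by
      rw [← Real.rpow_add hy, ← Real.rpow_add hy, ← Real.rpow_zero y]; congr 1; ring
    have e2 : y ^ (-(2 / p)) * y ^ (-γ) = y ^ (-η - 1) := by
      rw [← Real.rpow_add hy]; congr 1; rw [hγ]; ring
    have e3 : (y ^ (-(2 / p))) ^ (1 - p / 2) * y ^ (-γ) = y ^ (-η) := by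
      rw [← Real.rpow_mul hy.le, ← Real.rpow_add hy]; congr 1; rw [hγ]; field_simp; ring
    calc |h y| = |h y| * y ^ (2 * σ + 1 / 2) * (y ^ (γ - (2 * σ + 1 / 2)) * y ^ (-γ)) := by
          rw [mul_assoc, e1, mul_one]
      _ ≤ (y ^ (-(2 / p)) + |h y| ^ (p / 2) * y ^ ((2 * σ + 1 / 2) * (p / 2)) *
            (y ^ (-(2 / p))) ^ (1 - p / 2)) * (M * y ^ (-γ)) := by gcongr
      _ = M * (y ^ (-(2 / p)) * y ^ (-γ) + |h y| ^ (p / 2) * y ^ ((2 * σ + 1 / 2) * (p / 2)) *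
            ((y ^ (-(2 / p))) ^ (1 - p / 2) * y ^ (-γ))) := by ring
      _ = _ := by rw [e2, e3]
  have hgx : ∀ x, 0 < x → x ≤ t → |g x| ≤ B * x ^ (-η) := by
    intro x hx hxt
    have hsx := hsub x hx hxt
    have hhi : IntervalIntegrable h volume x t := (hh.mono hsx).intervalIntegrable
    have i1 : IntervalIntegrable (fun y : ℝ => y ^ (-η - 1)) volume x t :=
      ((hxc _).mono hsx).intervalIntegrable
    have i2 : IntervalIntegrable (fun y : ℝ =>
        |h y| ^ (p / 2) * y ^ ((2 * σ + 1 / 2) * (p / 2))) volume x t :=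
      ((hhr.mul (hxc _)).mono hsx).intervalIntegrable
    have hFTC := intervalIntegral.integral_eq_sub_of_hasDerivAt
      (fun y hy => hg y (hsx hy)) hhi
    have j1 : |∫ y in x..t, h y| ≤ ∫ y in x..t, |h y| :=
      intervalIntegral.abs_integral_le_integral_abs hxt
    have j2 : ∫ y in x..t, |h y| ≤ ∫ y in x..t, M * (y ^ (-η - 1) +
        |h y| ^ (p / 2) * y ^ ((2 * σ + 1 / 2) * (p / 2)) * x ^ (-η)) := by
      refine intervalIntegral.integral_mono_on hxt hhi.abs
        ((i1.add (i2.mul_const _)).const_mul M) fun y hy => ?_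
      have hy0 := hx.trans_le hy.1
      refine (hpt y hy0 hy.2).trans ?_
      have : y ^ (-η) ≤ x ^ (-η) := Real.rpow_le_rpow_of_nonpos hx hy.1 (by linarith)
      gcongr
    rw [intervalIntegral.integral_const_mul, intervalIntegral.integral_add i1 (i2.mul_const _),
      intervalIntegral.integral_mul_const, integral_rpow (Or.inr ⟨by linarith, fun h0 =>
        lt_irrefl (0 : ℝ) (hsx h0)⟩), show -η - 1 + 1 = -η by ring, ← neg_div_neg_eq, neg_neg] at j2
    have ht0 : 0 < t := hx.trans_le hxt
    have j3 : -(t ^ (-η) - x ^ (-η)) / η ≤ x ^ (-η) * (1 / η) := by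
      rw [mul_one_div]
      have : 0 < t ^ (-η) := by positivity
      gcongr; linarith
    have j4 := mul_le_mul_of_nonneg_right (hK x t hx hxt) (by positivity : 0 ≤ x ^ (-η))
    have j5 : (1 : ℝ) ≤ 2 ^ η * x ^ (-η) := by
      rw [Real.rpow_neg hx.le, ← div_eq_mul_inv, one_le_div (by positivity)]
      exact Real.rpow_le_rpow hx.le (hxt.trans ht) hη0.le
    have j6 : |g x| ≤ |g t| + |∫ y in x..t, h y| := by
      rw [hFTC, abs_sub_comm]
      have := abs_add_le (g t) (g x - g t)
      simpa using this
    have j7 := mul_le_mul_of_nonneg_left (add_le_add j3 j4) hM.le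
    calc |g x| ≤ 6 * (2 ^ η * x ^ (-η)) + M * (x ^ (-η) * (1 / η) + 1 * x ^ (-η)) := by linarith
      _ = B * x ^ (-η) := by simp only [B]; ring
  have hsa := hsub a ha hat
  have hmono : ∫ x in a..t, |g x| ^ p * x ^ (σ * p) ≤
      ∫ x in a..t, B ^ p * x ^ (σ * p - η * p) := by
    refine intervalIntegral.integral_mono_on hat ?_ ?_ fun x hx => ?_
    · exact ((((hgc.abs.rpow_const fun x _ => Or.inr hp0.le).mul (hxc _)).mono
        hsa).intervalIntegrable)
    · exact (((hxc _).mono hsa).intervalIntegrable).const_mul _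
    · have hx0 := ha.trans_le hx.1
      calc |g x| ^ p * x ^ (σ * p) ≤ (B * x ^ (-η)) ^ p * x ^ (σ * p) := by
            gcongr; exact hgx x hx0 hx.2
        _ = B ^ p * x ^ (σ * p - η * p) := by
            rw [Real.mul_rpow hB.le (by positivity), ← Real.rpow_mul hx0.le, mul_assoc,
              ← Real.rpow_add hx0]
            congr 2; ring
  refine hmono.trans ?_
  rw [intervalIntegral.integral_const_mul, integral_rpow (Or.inl (by linarith))]
  have ht0 : 0 < t := ha.trans_le hat
  have k1 : t ^ (σ * p - η * p + 1) ≤ 2 ^ (σ * p - η * p + 1) :=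
    Real.rpow_le_rpow ht0.le ht hs.le
  have k2 : 0 < a ^ (σ * p - η * p + 1) := by positivity
  gcongr
  linarith

theorem exists_integral_le {p σ : ℝ} (hp : 2 ≤ p) (hσ : -1 < σ * p)
    (hδ : σ * p < p / 2 - 1) :
    ∃ C : ℝ, 0 ≤ C ∧ ∀ f g h : ℝ → ℝ, (∀ x, 0 < x → HasDerivAt f (g x) x) →
      (∀ x, 0 < x → HasDerivAt g (h x) x) → ContinuousOn h (Ioi 0) →
      (∀ x, 0 < x → ∀ y, 0 < y → |f x - f y| ≤ √x + √y + √|x - y|) →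
      (∀ a b, 0 < a → a ≤ b →
        ∫ x in a..b, |h x| ^ (p / 2) * x ^ ((2 * σ + 1 / 2) * (p / 2)) ≤ 1) →
      ∀ a b, 0 < a → a ≤ b → ∫ x in a..b, |g x| ^ p * x ^ (σ * p) ≤ C := by
  obtain ⟨C₁, hC₁⟩ := exists_integral_far_le hp hδ
  obtain ⟨C₂, hC₂⟩ := exists_integral_near_le hp hσ hδ
  refine ⟨max (C₂ + C₁) 0, le_max_right _ _, ?_⟩
  intro f g h hf hg hh hF hK a b ha hab
  refine le_max_of_le_left ?_
  obtain ⟨t, ht, hgt⟩ := exists_abs_deriv_le hf hF one_pos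
  obtain ⟨s, hs, hgs⟩ := exists_abs_deriv_le hf hF (N := max b 2) (by positivity)
  have hbs : b < s := (le_max_left _ _).trans_lt hs.1
  have h2s : 2 < s := (le_max_right _ _).trans_lt hs.1
  have hts : t ≤ s := by linarith [ht.2]
  have hgt6 : |g t| ≤ 6 := by
    have : t ^ (-(1 / 2) : ℝ) ≤ 1 := Real.rpow_le_one_of_one_le_of_nonpos ht.1.le (by norm_num)
    linarith
  have ha' : 0 < min a 1 := lt_min ha one_pos
  have hat : min a 1 ≤ t := (min_le_right _ _).trans ht.1.le
  have hgc : ContinuousOn (fun x => |g x| ^ p * x ^ (σ * p)) (Ioi 0) := by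
    refine ContinuousOn.mul (ContinuousOn.rpow_const (ContinuousOn.abs fun x hx =>
      (hg x hx).continuousAt.continuousWithinAt) fun x _ => Or.inr (by linarith)) ?_
    exact continuousOn_id.rpow_const fun x hx => Or.inl (ne_of_gt hx)
  have hint : ∀ x y, 0 < x → x ≤ y →
      IntervalIntegrable (fun x => |g x| ^ p * x ^ (σ * p)) volume x y := fun x y hx hxy =>
    (hgc.mono (by rw [uIcc_of_le hxy]; exact fun z hz => hx.trans_le hz.1)).intervalIntegrable
  calc ∫ x in a..b, |g x| ^ p * x ^ (σ * p)
      ≤ ∫ x in min a 1..s, |g x| ^ p * x ^ (σ * p) := by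
        refine intervalIntegral.integral_mono_interval (min_le_left _ _) hab hbs.le ?_
          (hint _ _ ha' (hat.trans hts))
        refine (ae_restrict_iff' measurableSet_Ioc).2 (ae_of_all _ fun x hx => ?_)
        have : 0 < x := ha'.trans hx.1
        simp only [Pi.zero_apply]
        positivity
    _ = (∫ x in min a 1..t, |g x| ^ p * x ^ (σ * p)) + ∫ x in t..s, |g x| ^ p * x ^ (σ * p) :=
        (intervalIntegral.integral_add_adjacent_intervals (hint _ _ ha' hat)
          (hint _ _ (by linarith [ht.1]) hts)).symm
    _ ≤ C₂ + C₁ := add_le_add (hC₂ g h hg hh hK _ _ ha' hat (by linarith [ht.2]) hgt6)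
        (hC₁ f g h hf hg hh hF hK _ _ ht.1.le hts hgt hgs)

theorem exists_integral_le_mul {p σ : ℝ} (hp : 2 ≤ p) (hσ : -1 < σ * p)
    (hδ : σ * p < p / 2 - 1) :
    ∃ C : ℝ, 0 ≤ C ∧ ∀ f g h : ℝ → ℝ, ∀ H W : ℝ, 0 < H → 0 < W →
      (∀ x, 0 < x → HasDerivAt f (g x) x) →
      (∀ x, 0 < x → HasDerivAt g (h x) x) → ContinuousOn h (Ioi 0) →
      (∀ x, 0 < x → ∀ y, 0 < y → |f x - f y| ≤ H * (√x + √y + √|x - y|)) →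
      (∀ a b, 0 < a → a ≤ b →
        ∫ x in a..b, |h x| ^ (p / 2) * x ^ ((2 * σ + 1 / 2) * (p / 2)) ≤ W ^ (p / 2)) →
      ∀ a b, 0 < a → a ≤ b →
        ∫ x in a..b, |g x| ^ p * x ^ (σ * p) ≤ C * (H ^ (p / 2) * W ^ (p / 2)) := by
  obtain ⟨C, hC0, hC⟩ := exists_integral_le hp hσ hδ
  refine ⟨C, hC0, ?_⟩
  intro f g h H W hH hW hf hg hh hF hK a b ha hab
  have hδ0 : 0 < p / 2 - 1 - σ * p := by linarith
  set R : ℝ := ((H / W) ^ (p / 2)) ^ (p / 2 - 1 - σ * p)⁻¹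
  have hR : 0 < R := by positivity
  have hRδ : R ^ (p / 2 - 1 - σ * p) = (H / W) ^ (p / 2) :=
    Real.rpow_inv_rpow (by positivity) hδ0.ne'
  have hRx : ∀ x, 0 < x → HasDerivAt (fun y => R * y) R x := fun x _ => by
    simpa using (hasDerivAt_id x).const_mul R
  have hscale : ∀ (r s : ℝ) (k : ℝ → ℝ) (c : ℝ), 0 < c → ∀ a b, 0 < a → a ≤ b →
      ∫ x in a..b, |c * k (R * x)| ^ r * x ^ s =
        c ^ r * R ^ (-s - 1) * ∫ x in R * a..R * b, |k x| ^ r * x ^ s := by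
    intro r s k c hc a b ha hab
    have h1 := intervalIntegral.integral_comp_mul_left (a := a) (b := b)
      (fun x => |k x| ^ r * x ^ s) hR.ne'
    have h2 : ∫ x in a..b, |c * k (R * x)| ^ r * x ^ s =
        ∫ x in a..b, c ^ r * R ^ (-s) * (|k (R * x)| ^ r * (R * x) ^ s) := by
      refine intervalIntegral.integral_congr fun x hx => ?_
      rw [uIcc_of_le hab] at hx
      have hx0 : 0 < x := ha.trans_le hx.1
      rw [abs_mul, abs_of_pos hc, Real.mul_rpow hc.le (abs_nonneg _), Real.mul_rpow hR.le hx0.le]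
      have : R ^ (-s) * R ^ s = 1 := by rw [← Real.rpow_add hR]; simp
      linear_combination (-c ^ r * |k (R * x)| ^ r * x ^ s) * this
    rw [h2, intervalIntegral.integral_const_mul, h1, smul_eq_mul, Real.rpow_sub_one hR.ne']
    ring
  have hmain := hC (fun x => (H * √R)⁻¹ * f (R * x)) (fun x => (R * (H * √R)⁻¹) * g (R * x))
    (fun x => (R * R * (H * √R)⁻¹) * h (R * x)) ?_ ?_ ?_ ?_ ?_ (a / R) (b / R) (by positivity)
    (by gcongr)
  · rw [hscale p (σ * p) g _ (by positivity) _ _ (by positivity) (by gcongr),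
      mul_div_cancel₀ _ hR.ne', mul_div_cancel₀ _ hR.ne'] at hmain
    have e : (R * (H * √R)⁻¹) ^ p * R ^ (-(σ * p) - 1) = (H ^ (p / 2) * W ^ (p / 2))⁻¹ := by
      have e1 : R * (H * √R)⁻¹ = H⁻¹ * R ^ (1 / 2 : ℝ) := by
        rw [← Real.sqrt_eq_rpow]
        have := Real.mul_self_sqrt hR.le
        have h0 := Real.sqrt_pos.2 hR
        field_simp
        linarith
      have e2 : H ^ p = H ^ (p / 2) * H ^ (p / 2) := by
        rw [← Real.rpow_add hH]; congr 1; ring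
      rw [e1, Real.mul_rpow (by positivity) (by positivity), ← Real.rpow_mul hR.le, mul_assoc,
        ← Real.rpow_add hR, show 1 / 2 * p + (-(σ * p) - 1) = p / 2 - 1 - σ * p by ring, hRδ,
        Real.inv_rpow hH.le, Real.div_rpow hH.le hW.le, e2]
      have := Real.rpow_pos_of_pos hH (p / 2)
      have := Real.rpow_pos_of_pos hW (p / 2)
      field_simp
    rw [e, inv_mul_le_iff₀ (by positivity)] at hmain
    exact hmain.trans_eq (mul_comm _ _)
  · intro x hx
    have h1 := ((hf (R * x) (by positivity)).comp x (hRx x hx)).const_mul (H * √R)⁻¹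
    refine h1.congr_deriv ?_
    ring
  · intro x hx
    have h1 := ((hg (R * x) (by positivity)).comp x (hRx x hx)).const_mul (R * (H * √R)⁻¹)
    refine h1.congr_deriv ?_
    ring
  · refine continuousOn_const.mul (hh.comp (continuousOn_const.mul continuousOn_id) ?_)
    exact fun x hx => mul_pos hR hx
  · intro x hx y hy
    have h1 := hF (R * x) (by positivity) (R * y) (by positivity)
    rw [← mul_sub, abs_mul, abs_of_pos hR, Real.sqrt_mul hR.le, Real.sqrt_mul hR.le,
      Real.sqrt_mul hR.le] at h1
    have h0 := Real.sqrt_pos.2 hR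
    rw [← mul_sub, abs_mul, abs_of_pos (by positivity : 0 < (H * √R)⁻¹),
      inv_mul_le_iff₀ (by positivity)]
    linarith
  · intro a b ha hab
    rw [hscale _ _ h _ (by positivity) _ _ ha hab]
    have e : (R * R * (H * √R)⁻¹) ^ (p / 2) * R ^ (-((2 * σ + 1 / 2) * (p / 2)) - 1) =
        (W ^ (p / 2))⁻¹ := by
      have e1 : R * R * (H * √R)⁻¹ = H⁻¹ * R ^ (3 / 2 : ℝ) := by
        rw [show (3 / 2 : ℝ) = 1 + 1 / 2 by norm_num, Real.rpow_add hR, Real.rpow_one,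
          ← Real.sqrt_eq_rpow]
        have := Real.mul_self_sqrt hR.le
        have h0 := Real.sqrt_pos.2 hR
        field_simp
        linarith
      rw [e1, Real.mul_rpow (by positivity) (by positivity), ← Real.rpow_mul hR.le, mul_assoc,
        ← Real.rpow_add hR,
        show 3 / 2 * (p / 2) + (-((2 * σ + 1 / 2) * (p / 2)) - 1) = p / 2 - 1 - σ * p by ring, hRδ,
        Real.inv_rpow hH.le, Real.div_rpow hH.le hW.le]
      have := Real.rpow_pos_of_pos hH (p / 2)
      have := Real.rpow_pos_of_pos hW (p / 2)
      field_simp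
    rw [e, inv_mul_le_iff₀ (by positivity), mul_one]
    exact hK _ _ (by positivity) (by gcongr)

theorem wLp_rpow_eq {σ : ℝ} {p : ℝ≥0∞} (hp0 : p ≠ 0) (hp : p ≠ ⊤) (f : ℝ → ℝ) :
    wLp σ p f ^ p.toReal = ∫⁻ x in Ioi 0, ‖x ^ σ * f x‖ₑ ^ p.toReal := by
  rw [wLp, eLpNorm_eq_lintegral_rpow_enorm_toReal hp0 hp, one_div,
    ENNReal.rpow_inv_rpow (ENNReal.toReal_pos hp0 hp).ne']

theorem ofReal_integral_eq_setLIntegral {s r a b : ℝ} {k : ℝ → ℝ} (hk : ContinuousOn k (Ioi 0))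
    (hr : 0 ≤ r) (ha : 0 < a) (hab : a ≤ b) :
    ENNReal.ofReal (∫ x in a..b, |k x| ^ r * x ^ (s * r)) =
      ∫⁻ x in Ioc a b, ‖x ^ s * k x‖ₑ ^ r := by
  have hc : ContinuousOn (fun x => |k x| ^ r * x ^ (s * r)) (uIcc a b) := by
    refine ContinuousOn.mono (s := Ioi 0) ?_ ?_
    · exact (hk.abs.rpow_const fun x _ => Or.inr hr).mul
        (continuousOn_id.rpow_const fun x hx => Or.inl (ne_of_gt hx))
    · rw [uIcc_of_le hab]; exact fun z hz => ha.trans_le hz.1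
  have hpos : ∀ x ∈ Ioc a b, 0 < x := fun x hx => ha.trans hx.1
  rw [intervalIntegral.integral_of_le hab, ofReal_integral_eq_lintegral_ofReal
    ((intervalIntegrable_iff_integrableOn_Ioc_of_le hab).1 hc.intervalIntegrable)]
  · refine setLIntegral_congr_fun measurableSet_Ioc fun x hx => ?_
    have hx0 := hpos x hx
    rw [abs_rpow_mul_rpow hx0, Real.enorm_eq_ofReal_abs,
      ENNReal.ofReal_rpow_of_nonneg (abs_nonneg _) hr, abs_mul,
      abs_of_pos (Real.rpow_pos_of_pos hx0 s), mul_comm]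
  · refine (ae_restrict_iff' measurableSet_Ioc).2 (ae_of_all _ fun x hx => ?_)
    have := hpos x hx
    simp only [Pi.zero_apply]
    positivity

theorem setLIntegral_Ioi_zero_le {F : ℝ → ℝ≥0∞} {c : ℝ≥0∞}
    (h : ∀ a b, 0 < a → a ≤ b → ∫⁻ x in Ioc a b, F x ≤ c) : ∫⁻ x in Ioi 0, F x ≤ c := by
  have hU : Ioi (0 : ℝ) = ⋃ n : ℕ, Ioc (1 / ((n : ℝ) + 1)) (n + 1) := by
    ext x
    simp only [mem_Ioi, mem_iUnion, mem_Ioc]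
    constructor
    · intro hx
      obtain ⟨n, hn⟩ := exists_nat_one_div_lt hx
      obtain ⟨m, hm⟩ := exists_nat_ge x
      refine ⟨max n m, (lt_of_le_of_lt ?_ hn), ?_⟩
      · have : (n : ℝ) ≤ (max n m : ℕ) := by exact_mod_cast le_max_left n m
        gcongr
      · have : (m : ℝ) ≤ (max n m : ℕ) := by exact_mod_cast le_max_right n m
        linarith
    · rintro ⟨n, hn, -⟩
      exact lt_trans (by positivity) hn
  have hmono : Monotone fun n : ℕ => Ioc (1 / ((n : ℝ) + 1)) (n + 1) := by
    intro n m hnm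
    have : (n : ℝ) ≤ m := by exact_mod_cast hnm
    exact Ioc_subset_Ioc (by gcongr) (by gcongr)
  rw [hU, setLIntegral_iUnion_of_directed _ hmono.directed_le]
  refine iSup_le fun n => h _ _ (by positivity) ?_
  have : (0 : ℝ) ≤ n := n.cast_nonneg
  rw [div_le_iff₀ (by positivity)]
  nlinarith

/-- **One-dimensional weighted interpolation against the adapted Hölder norm**
(Lemma 2.22 with `d = 1`): for `p₁ ∈ [2,∞)`, `p₂ = p₁/2`, `σ₂ - 1/2 = 2σ₁`,
`2 - 1/p₂ > σ₂ + 1/2` and `σ₁ > -1/p₁`, one has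
`‖x^{σ₁} f'‖_{L^{p₁}} ≤ C ‖f‖_{C̃^{0,1/2}}^{1/2} ‖x^{σ₂} f''‖_{L^{p₂}}^{1/2}`,
the adapted Hölder norm (with weight `r(x) = x`) being expressed through an
arbitrary bound `H`. -/
theorem weighted_interpolation_adapted_holder
    (p₁ : ℝ≥0∞) (σ₁ σ₂ : ℝ)
    (hp₁ : 2 ≤ p₁) (hp₁top : p₁ ≠ ⊤)
    (hσrel : σ₂ - 1 / 2 = 2 * σ₁)
    (hmain : σ₂ + 1 / 2 < 2 - (1 / (p₁ / 2)).toReal)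
    (hσ₁ : -(1 / p₁).toReal < σ₁) :
    ∃ C : ℝ≥0∞, C ≠ ⊤ ∧ ∀ f : ℝ → ℝ, ContDiffOn ℝ 2 f (Set.Ioi 0) →
      ∀ H : ℝ, 0 ≤ H →
      (∀ x ∈ Set.Ioi (0:ℝ), ∀ y ∈ Set.Ioi (0:ℝ),
        |f x - f y| ≤ H * (Real.sqrt x + Real.sqrt y + Real.sqrt |x - y|)) →
      wLp σ₂ (p₁ / 2) (deriv (deriv f)) < ⊤ →
      wLp σ₁ p₁ (deriv f)
        ≤ C * ENNReal.ofReal H ^ (1/2 : ℝ) *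
            wLp σ₂ (p₁ / 2) (deriv (deriv f)) ^ (1/2 : ℝ) := by
  set p : ℝ := p₁.toReal with hpdef
  have hp : 2 ≤ p := (ENNReal.toReal_mono hp₁top hp₁ : _)
  have hp0 : 0 < p := by linarith
  have hp₁0 : p₁ ≠ 0 := (lt_of_lt_of_le (by norm_num) hp₁).ne'
  have hq0 : p₁ / 2 ≠ 0 := ENNReal.div_ne_zero.2 ⟨hp₁0, by norm_num⟩
  have hqtop : p₁ / 2 ≠ ⊤ := ENNReal.div_ne_top hp₁top (by norm_num)
  have hqp : (p₁ / 2).toReal = p / 2 := by rw [ENNReal.toReal_div, hpdef]; simp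
  have hσ₂ : σ₂ = 2 * σ₁ + 1 / 2 := by linarith
  have hσ : -1 < σ₁ * p := by
    rw [ENNReal.toReal_div, ENNReal.toReal_one, ← neg_div, div_lt_iff₀ hp0] at hσ₁
    exact hσ₁
  have hδ : σ₁ * p < p / 2 - 1 := by
    rw [ENNReal.toReal_div, ENNReal.toReal_one, hqp, hσ₂, lt_sub_iff_add_lt, ← lt_sub_iff_add_lt',
      div_lt_iff₀ (by linarith)] at hmain
    linarith
  obtain ⟨C, hC0, hC⟩ := exists_integral_le_mul hp hσ hδ
  refine ⟨ENNReal.ofReal C ^ (1 / p), by finiteness, ?_⟩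
  intro f hf H hH hF hfin
  have hf1 := (contDiffOn_succ_iff_deriv_of_isOpen (n := 1) isOpen_Ioi).1 hf
  have hf2 := (contDiffOn_succ_iff_deriv_of_isOpen (n := 0) isOpen_Ioi).1 hf1.2.2
  have hfd : ∀ x, 0 < x → HasDerivAt f (deriv f x) x := fun x hx =>
    (hf1.1.differentiableAt (Ioi_mem_nhds hx)).hasDerivAt
  have hgd : ∀ x, 0 < x → HasDerivAt (deriv f) (deriv (deriv f) x) x := fun x hx =>
    (hf2.1.differentiableAt (Ioi_mem_nhds hx)).hasDerivAt
  have hhc : ContinuousOn (deriv (deriv f)) (Ioi 0) := hf2.2.2.continuousOn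
  set J := wLp σ₂ (p₁ / 2) (deriv (deriv f)) with hJ
  have key : ∀ ε : ℝ, 0 < ε → wLp σ₁ p₁ (deriv f) ≤ ENNReal.ofReal C ^ (1 / p) *
      ENNReal.ofReal (H + ε) ^ (1 / 2 : ℝ) * ENNReal.ofReal (J.toReal + ε) ^ (1 / 2 : ℝ) := by
    intro ε hε
    have hH' : 0 < H + ε := by linarith
    have hW' : 0 < J.toReal + ε := by have := J.toReal_nonneg; linarith
    have hJW : J ≤ ENNReal.ofReal (J.toReal + ε) := by
      rw [← ENNReal.ofReal_toReal hfin.ne]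
      exact ENNReal.ofReal_le_ofReal (by rw [ENNReal.toReal_ofReal] <;> simp [hε.le])
    have h1 := hC f (deriv f) (deriv (deriv f)) (H + ε) (J.toReal + ε) hH' hW' hfd hgd hhc
      (fun x hx y hy => (hF x hx y hy).trans (by gcongr; linarith))
      (fun a b ha hab => by
        rw [← hσ₂, ← ENNReal.ofReal_le_ofReal_iff (by positivity),
          ofReal_integral_eq_setLIntegral hhc (by linarith) ha hab,
          ← ENNReal.ofReal_rpow_of_pos hW']
        refine (lintegral_mono_set (Ioc_subset_Ioi_self.trans (Ioi_subset_Ioi ha.le))).trans ?_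
        rw [← hqp, ← wLp_rpow_eq hq0 hqtop]
        gcongr)
    have h2 : wLp σ₁ p₁ (deriv f) ^ p ≤ ENNReal.ofReal
        (C * ((H + ε) ^ (p / 2) * (J.toReal + ε) ^ (p / 2))) := by
      rw [wLp_rpow_eq hp₁0 hp₁top]
      refine setLIntegral_Ioi_zero_le fun a b ha hab => ?_
      rw [← ofReal_integral_eq_setLIntegral hf1.2.2.continuousOn hp0.le ha hab]
      exact ENNReal.ofReal_le_ofReal (h1 a b ha hab)
    rw [← ENNReal.le_rpow_inv_iff hp0] at h2
    refine h2.trans_eq ?_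
    rw [ENNReal.ofReal_mul hC0, ENNReal.ofReal_mul (by positivity),
      ENNReal.mul_rpow_of_nonneg _ _ (by positivity), ENNReal.mul_rpow_of_nonneg _ _ (by positivity),
      ← ENNReal.ofReal_rpow_of_pos hH', ← ENNReal.ofReal_rpow_of_pos hW', ← ENNReal.rpow_mul,
      ← ENNReal.rpow_mul, show p / 2 * p⁻¹ = 1 / 2 by field_simp, one_div p, mul_assoc]
  have hlim : Filter.Tendsto (fun ε : ℝ => ENNReal.ofReal C ^ (1 / p) *
      ENNReal.ofReal (H + ε) ^ (1 / 2 : ℝ) * ENNReal.ofReal (J.toReal + ε) ^ (1 / 2 : ℝ))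
      (nhdsWithin 0 (Ioi 0)) (nhds (ENNReal.ofReal C ^ (1 / p) *
      ENNReal.ofReal H ^ (1 / 2 : ℝ) * J ^ (1 / 2 : ℝ))) := by
    have ht : ∀ c : ℝ, Filter.Tendsto (fun ε : ℝ => ENNReal.ofReal (c + ε) ^ (1 / 2 : ℝ))
        (nhdsWithin 0 (Ioi 0)) (nhds (ENNReal.ofReal c ^ (1 / 2 : ℝ))) := by
      intro c
      have hcont : Continuous fun ε : ℝ => ENNReal.ofReal (c + ε) ^ (1 / 2 : ℝ) :=
        ENNReal.continuous_rpow_const.comp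
          (ENNReal.continuous_ofReal.comp (continuous_const.add continuous_id))
      have := (hcont.tendsto 0).mono_left (nhdsWithin_le_nhds (s := Ioi 0))
      rwa [add_zero] at this
    have hJt := ht J.toReal
    rw [ENNReal.ofReal_toReal hfin.ne] at hJt
    refine ENNReal.Tendsto.mul (ENNReal.Tendsto.const_mul (ht H) (Or.inr (by finiteness)))
      (Or.inr ?_) hJt (Or.inr (by finiteness))
    exact ENNReal.rpow_ne_top_of_nonneg (by norm_num) hfin.ne
  exact ge_of_tendsto hlim (by filter_upwards [self_mem_nhdsWithin] with ε hε using key ε hε)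
end
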